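/- arXiv:1512.01369 — 2 statements merged into one kernel-verified Lean document; each statement's English description precedes it below -/
import Mathlib

section
/- For every ε > 0 there exists δ > 0 such that for every prime p and every subset A of the field 𝔽_p with |A| ≥ 2, at least one of the following holds: |A+A| > |A|^{1+δ}, or |A·A| > |A|^{1+δ}, or |A| > p^{1-ε}. -/
open Pointwise

/-- Cauchy–Schwarz: a small image forces many collisions. -/
theorem Finset.card_sq_le_card_image_mul_card_collisions {α β : Type*} [DecidableEq β]
    (s : Finset α) (f : α → β) :
    s.card ^ 2 ≤ (s.image f).card * ((s ×ˢ s).filter fun x ↦ f x.1 = f x.2).card := by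
  have h : ((s ×ˢ s).filter fun x ↦ f x.1 = f x.2).card =
      ∑ y ∈ s.image f, (s.filter fun x ↦ f x = y).card ^ 2 := by
    rw [Finset.card_eq_sum_card_fiberwise (f := fun x ↦ f x.1) (t := s.image f)]
    · refine Finset.sum_congr rfl fun y _ ↦ ?_
      rw [sq, ← Finset.card_product]
      congr 1
      ext ⟨a, b⟩
      simp only [Finset.mem_filter, Finset.mem_product]
      grind
    · intro x hx
      simp only [Finset.coe_filter, Finset.mem_product, Set.mem_ofPred_eq] at hx
      exact Finset.mem_coe.2 (Finset.mem_image_of_mem _ hx.1.1)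
  rw [h, Finset.card_eq_sum_card_image f s]
  exact sq_sum_le_card_mul_sum_sq

/-- Some dilate `η • B` has few additive coincidences with `B`. -/
theorem exists_min_card_sq_le_two_mul_card_image {F : Type*} [Field F] [Fintype F] [DecidableEq F]
    (B : Finset F) :
    ∃ η : F, min (B.card ^ 2) (Fintype.card F) ≤
      2 * ((B ×ˢ B).image fun x ↦ x.1 + η * x.2).card := by
  obtain rfl | hB := B.eq_empty_or_nonempty
  · simp
  set P := B ×ˢ B
  have hP : P.card = B.card ^ 2 := by rw [Finset.card_product, sq]
  set E : F → ℕ := fun η ↦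
    ((P ×ˢ P).filter fun z ↦ z.1.1 + η * z.1.2 = z.2.1 + η * z.2.2).card
  have hsum : ∑ η, E η ≤ P.card ^ 2 + Fintype.card F * P.card := by
    calc ∑ η, E η = ∑ z ∈ P ×ˢ P,
          (Finset.univ.filter fun η : F ↦ z.1.1 + η * z.1.2 = z.2.1 + η * z.2.2).card := by
          simp only [E, Finset.card_filter]
          exact Finset.sum_comm
      _ ≤ ∑ z ∈ P ×ˢ P, (1 + if z.1 = z.2 then Fintype.card F else 0) := by
          refine Finset.sum_le_sum fun z _ ↦ ?_
          split_ifs with h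
          · exact (Finset.card_le_univ _).trans (by omega)
          · refine Finset.card_le_one.2 fun η hη η' hη' ↦ ?_
            simp only [Finset.mem_filter, Finset.mem_univ, true_and] at hη hη'
            have h2 : z.1.2 - z.2.2 ≠ 0 := fun h0 ↦ h <| by
              have h1 := sub_eq_zero.1 h0
              rw [h1] at hη
              exact Prod.ext (add_right_cancel hη) h1
            refine mul_right_cancel₀ h2 ?_
            linear_combination hη - hη'
      _ = P.card ^ 2 + Fintype.card F * P.card := by
          rw [Finset.sum_add_distrib, Finset.sum_product P P fun z ↦
            if z.1 = z.2 then Fintype.card F else 0]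
          simp [sq, mul_comm]
  obtain ⟨η, -, hη⟩ := Finset.exists_le_of_sum_le (s := Finset.univ)
    (f := fun η ↦ Fintype.card F * E η)
    (g := fun _ : F ↦ P.card ^ 2 + Fintype.card F * P.card) Finset.univ_nonempty (by
      rw [← Finset.mul_sum, Finset.sum_const, smul_eq_mul, Finset.card_univ]
      gcongr)
  refine ⟨η, ?_⟩
  have hcs := P.card_sq_le_card_image_mul_card_collisions fun x ↦ x.1 + η * x.2
  change _ ≤ _ * E η at hcs
  rw [← hP]
  have hPpos : 0 < P.card := (hB.product hB).card_pos
  generalize (P.image fun x ↦ x.1 + η * x.2).card = I at *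
  generalize E η = e at *
  have hq : 0 < Fintype.card F := Fintype.card_pos
  generalize Fintype.card F = q at *
  generalize P.card = n at *
  rcases le_total n q with h | h
  · rw [min_eq_left h]
    have he : e ≤ 2 * n := Nat.le_of_mul_le_mul_left (by nlinarith : q * e ≤ q * (2 * n)) hq
    refine Nat.le_of_mul_le_mul_left (?_ : n * n ≤ n * (2 * I)) hPpos
    nlinarith
  · rw [min_eq_right h]
    have he : q * e ≤ 2 * n ^ 2 := by nlinarith
    refine Nat.le_of_mul_le_mul_left (?_ : n ^ 2 * q ≤ n ^ 2 * (2 * I)) (by positivity)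
    nlinarith

/-- A subset of a prime field expands under a linear form whose coefficients are built from
differences of its own elements. -/
theorem ZMod.exists_min_card_sq_le_two_mul_card_image {p : ℕ} [Fact p.Prime]
    {B : Finset (ZMod p)} (hB : B.Nonempty) :
    ∃ a ∈ B, ∃ b ∈ B, ∃ c ∈ B, ∃ d ∈ B, min (B.card ^ 2) p ≤
      2 * ((B ×ˢ B).image fun x ↦ (c - d) * x.1 + ((a - b) + (c - d)) * x.2).card := by
  obtain ⟨x₀, hx₀⟩ := hB
  by_cases h1 : B.card ≤ 1
  · refine ⟨x₀, hx₀, x₀, hx₀, x₀, hx₀, x₀, hx₀, (min_le_left _ _).trans ?_⟩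
    have : 0 < ((B ×ˢ B).image fun x ↦
        (x₀ - x₀) * x.1 + ((x₀ - x₀) + (x₀ - x₀)) * x.2).card :=
      Finset.card_pos.2 (Finset.Nonempty.image ⟨(x₀, x₀), by simp [hx₀]⟩ _)
    nlinarith
  obtain ⟨c₀, hc₀, d₀, hd₀, hcd₀⟩ := Finset.one_lt_card.1 (not_le.1 h1)
  set R : Set (ZMod p) :=
    {ξ | ∃ a ∈ B, ∃ b ∈ B, ∃ c ∈ B, ∃ d ∈ B, c ≠ d ∧ ξ * (c - d) = a - b}
  suffices H : ∃ ξ ∈ R, min (B.card ^ 2) p ≤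
      2 * ((B ×ˢ B).image fun x ↦ x.1 + (ξ + 1) * x.2).card by
    obtain ⟨ξ, ⟨a, ha, b, hb, c, hc, d, hd, hcd, hξ⟩, H⟩ := H
    refine ⟨a, ha, b, hb, c, hc, d, hd, H.trans_eq ?_⟩
    rw [← Finset.card_image_of_injective _ (mul_right_injective₀ (sub_ne_zero.2 hcd)),
      Finset.image_image]
    congr 3
    funext x
    simp only [Function.comp_apply]
    linear_combination x.2 * hξ
  by_cases hR : ∀ ξ, ξ ∈ R
  · obtain ⟨η, hη⟩ := _root_.exists_min_card_sq_le_two_mul_card_image B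
    rw [ZMod.card] at hη
    exact ⟨η - 1, hR _, by simpa using hη⟩
  have hstep : ∃ ξ ∈ R, ξ + 1 ∉ R := by
    by_contra! hc
    have hn : ∀ n : ℕ, (n : ZMod p) ∈ R := by
      intro n
      induction n with
      | zero => exact ⟨c₀, hc₀, c₀, hc₀, c₀, hc₀, d₀, hd₀, hcd₀, by simp⟩
      | succ n ih => simpa using hc _ ih
    exact hR fun ξ ↦ by simpa using hn ξ.val
  obtain ⟨ξ, hξ, hξ1⟩ := hstep
  refine ⟨ξ, hξ, (min_le_left _ _).trans ?_⟩
  rw [Finset.card_image_of_injOn, Finset.card_product, sq]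
  · omega
  rintro ⟨x, y⟩ hxy ⟨z, w⟩ hzw h
  simp only [Finset.coe_product, Set.mem_prod, Finset.mem_coe] at hxy hzw h
  have hyw : y = w := by
    by_contra hne
    exact hξ1 ⟨z, hzw.1, x, hxy.1, y, hxy.2, w, hzw.2, hne, by linear_combination h⟩
  subst hyw
  simpa using h

/-- If `A * A` is small then some dilate of `A` meets many of the other dilates substantially. -/
theorem Finset.exists_popular_dilate {F : Type*} [Field F] [DecidableEq F] {A : Finset F}
    (hA : A.Nonempty) (h0 : (0 : F) ∉ A) {K : ℝ} (hK : 0 < K)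
    (hmul : ((A * A).card : ℝ) ≤ K * A.card) :
    ∃ b ∈ A, ∃ B ⊆ A, (A.card : ℝ) ≤ 2 * K * B.card ∧
      ∀ t ∈ B, (A.card : ℝ) ≤ 2 * K * (t • A ∩ b • A).card := by
  have hn : (0 : ℝ) < A.card := by exact_mod_cast hA.card_pos
  have hcs := (A ×ˢ A).card_sq_le_card_image_mul_card_collisions fun x ↦ x.1 * x.2
  have himg : (A ×ˢ A).image (fun x ↦ x.1 * x.2) = A * A := rfl
  have hE : (((A ×ˢ A) ×ˢ (A ×ˢ A)).filter fun z ↦ z.1.1 * z.1.2 = z.2.1 * z.2.2).card =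
      ∑ b ∈ A, ∑ t ∈ A, (t • A ∩ b • A).card := by
    rw [← Finset.sum_product' (f := fun b t ↦ (t • A ∩ b • A).card),
      Finset.card_eq_sum_card_fiberwise (f := fun z ↦ (z.1.1, z.2.1)) (t := A ×ˢ A)]
    · refine Finset.sum_congr rfl fun ⟨b, t⟩ hbt ↦ ?_
      simp only [Finset.mem_product] at hbt
      have hb : b ≠ 0 := fun h ↦ h0 (h ▸ hbt.1)
      have ht : t ≠ 0 := fun h ↦ h0 (h ▸ hbt.2)
      refine Finset.card_bij (fun z _ ↦ z.1.1 * z.1.2) ?_ ?_ ?_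
      · rintro ⟨⟨a, x⟩, ⟨c, y⟩⟩ hz
        simp only [Finset.mem_filter, Finset.mem_product, Prod.mk.injEq] at hz
        obtain ⟨⟨⟨⟨-, hx⟩, -, hy⟩, he⟩, rfl, rfl⟩ := hz
        refine Finset.mem_inter.2 ⟨?_, Finset.smul_mem_smul_finset hx⟩
        change a * x ∈ _
        rw [he]
        exact Finset.smul_mem_smul_finset hy
      · rintro ⟨⟨a, x⟩, ⟨c, y⟩⟩ hz ⟨⟨a', x'⟩, ⟨c', y'⟩⟩ hz' h
        simp only [Finset.mem_filter, Finset.mem_product, Prod.mk.injEq] at hz hz' h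
        obtain ⟨⟨-, he⟩, rfl, rfl⟩ := hz
        obtain ⟨⟨-, he'⟩, rfl, rfl⟩ := hz'
        have := mul_left_cancel₀ hb h
        have := mul_left_cancel₀ ht (he.symm.trans (h.trans he'))
        simp [*]
      · intro y hy
        obtain ⟨hy1, hy2⟩ := Finset.mem_inter.1 hy
        obtain ⟨u, hu, hu'⟩ := Finset.mem_smul_finset.1 hy1
        obtain ⟨v, hv, hv'⟩ := Finset.mem_smul_finset.1 hy2
        exact ⟨((b, v), (t, u)), by simp_all [smul_eq_mul], by simpa using hv'⟩
    · intro z hz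
      simp only [Finset.coe_filter, Finset.mem_product, Set.mem_ofPred_eq] at hz
      simp [hz]
  rw [himg, hE, Finset.card_product] at hcs
  have hcs' : (A.card : ℝ) ^ 4 ≤ K * A.card * ∑ b ∈ A, ∑ t ∈ A, ((t • A ∩ b • A).card : ℝ) := by
    calc (A.card : ℝ) ^ 4 = (A.card * A.card : ℝ) ^ 2 := by ring
      _ ≤ (A * A).card * ∑ b ∈ A, ∑ t ∈ A, ((t • A ∩ b • A).card : ℝ) := by exact_mod_cast hcs
      _ ≤ _ := by gcongr
  obtain ⟨b, hb, hbs⟩ := Finset.exists_le_of_sum_le (s := A) (f := fun _ ↦ (A.card : ℝ) ^ 2)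
    (g := fun b ↦ K * ∑ t ∈ A, ((t • A ∩ b • A).card : ℝ)) hA (by
      rw [← Finset.mul_sum, Finset.sum_const, nsmul_eq_mul]
      refine le_of_mul_le_mul_left ?_ hn
      linarith)
  set B := A.filter fun t ↦ (A.card : ℝ) ≤ 2 * K * (t • A ∩ b • A).card
  refine ⟨b, hb, B, Finset.filter_subset _ _, ?_, fun t ht ↦ (Finset.mem_filter.1 ht).2⟩
  have hub : 2 * K * ∑ t ∈ A, ((t • A ∩ b • A).card : ℝ) ≤
      A.card * A.card + B.card * (2 * K * A.card) := by
    calc 2 * K * ∑ t ∈ A, ((t • A ∩ b • A).card : ℝ)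
        ≤ ∑ t ∈ A, ((A.card : ℝ) +
            if (A.card : ℝ) ≤ 2 * K * (t • A ∩ b • A).card then 2 * K * A.card else 0) := by
          rw [Finset.mul_sum]
          refine Finset.sum_le_sum fun t _ ↦ ?_
          split_ifs with h
          · have : (t • A ∩ b • A).card ≤ A.card :=
              (Finset.card_le_card Finset.inter_subset_left).trans Finset.card_image_le
            have : ((t • A ∩ b • A).card : ℝ) ≤ A.card := by exact_mod_cast this
            nlinarith
          · linarith
      _ = _ := by
          rw [Finset.sum_add_distrib, ← Finset.sum_filter]
          simp [B]
  refine le_of_mul_le_mul_left ?_ hn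
  nlinarith

/-- A set of small doubling with a large overlap with `S` is covered by few translates of `S - S`. -/
theorem Finset.exists_card_le_and_subset_add_sub_of_inter {G : Type*} [AddCommGroup G]
    [DecidableEq G] {T S : Finset G} {L M : ℝ} {n : ℕ} (hn : 0 < n)
    (hT : ((T + T).card : ℝ) ≤ M * n) (hTS : (n : ℝ) ≤ L * (T ∩ S).card) (hM : 0 ≤ M) :
    ∃ X : Finset G, (X.card : ℝ) ≤ L * M ∧ T ⊆ X + (S - S) := by
  have hn' : (0 : ℝ) < n := by exact_mod_cast hn
  have hne : (T ∩ S).Nonempty := by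
    by_contra h
    rw [Finset.not_nonempty_iff_eq_empty] at h
    simp [h] at hTS
    omega
  obtain ⟨X, -, hX, hcov⟩ := Finset.ruzsa_covering_add (K := L * M) (A := T) hne (by
    calc ((T + T ∩ S).card : ℝ) ≤ (T + T).card := by
          exact_mod_cast Finset.card_le_card
            (Finset.add_subset_add_left Finset.inter_subset_left)
      _ ≤ M * n := hT
      _ ≤ M * (L * (T ∩ S).card) := by gcongr
      _ = _ := by ring)
  exact ⟨X, hX, hcov.trans <| Finset.add_subset_add_left <|
    Finset.sub_subset_sub Finset.inter_subset_right Finset.inter_subset_right⟩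

/-- The Plünnecke–Ruzsa inequality for `6S - 6S`, with the sums written out. -/
theorem Finset.card_six_add_sub_six_add_le {G : Type*} [AddCommGroup G] [DecidableEq G]
    {S : Finset G} (hS : S.Nonempty) {K : ℝ} (hK : ((S + S).card : ℝ) ≤ K * S.card) :
    (((S + S + S + S + S + S) - (S + S + S + S + S + S)).card : ℝ) ≤ K ^ 12 * S.card := by
  have h := Finset.pluennecke_ruzsa_inequality_nsmul_sub_nsmul_add hS S 6 6
  simp only [succ_nsmul, zero_nsmul, zero_add] at h
  have h' : (((S + S + S + S + S + S) - (S + S + S + S + S + S)).card : ℝ) ≤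
      ((S + S).card / S.card : ℝ) ^ 12 * S.card := by
    have h2 := (NNRat.cast_le (K := ℝ)).2 h
    push_cast at h2
    exact h2
  have hs : (0 : ℝ) < S.card := by exact_mod_cast hS.card_pos
  refine h'.trans ?_
  gcongr
  exact (div_le_iff₀ hs).2 hK

/-- If every element of `B` dilates `A` into few translates of `S - S`, then linear forms with
coefficients in `B - B` take few values on `A`. -/
theorem Finset.card_image_le_of_subset_add_sub {F : Type*} [Field F] [DecidableEq F]
    {A B S : Finset F} (hBA : B ⊆ A) (hS : S.Nonempty) {K L : ℝ} (hL : 0 ≤ L)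
    (hK : ((S + S).card : ℝ) ≤ K * S.card)
    (hcov : ∀ t ∈ B, ∃ X : Finset F, (X.card : ℝ) ≤ L ∧ t • A ⊆ X + (S - S))
    {a b c d : F} (ha : a ∈ B) (hb : b ∈ B) (hc : c ∈ B) (hd : d ∈ B) :
    (((B ×ˢ B).image fun x ↦ (c - d) * x.1 + ((a - b) + (c - d)) * x.2).card : ℝ) ≤
      L ^ 6 * (K ^ 12 * S.card) := by
  choose! X hX hXcov using hcov
  have hmem : ∀ t ∈ B, ∀ x ∈ B, ∃ f ∈ X t, ∃ u ∈ S, ∃ v ∈ S, f + (u - v) = t * x := by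
    intro t ht x hx
    obtain ⟨f, hf, w, hw, h⟩ := Finset.mem_add.1
      (hXcov t ht (Finset.smul_mem_smul_finset (hBA hx)))
    obtain ⟨u, hu, v, hv, rfl⟩ := Finset.mem_sub.1 hw
    exact ⟨f, hf, u, hu, v, hv, h⟩
  have hsix : ∀ {x₁ x₂ x₃ x₄ x₅ x₆ : F}, x₁ ∈ S → x₂ ∈ S → x₃ ∈ S → x₄ ∈ S → x₅ ∈ S → x₆ ∈ S →
      x₁ + x₂ + x₃ + x₄ + x₅ + x₆ ∈ S + S + S + S + S + S := fun h₁ h₂ h₃ h₄ h₅ h₆ ↦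
    Finset.add_mem_add (Finset.add_mem_add (Finset.add_mem_add (Finset.add_mem_add
      (Finset.add_mem_add h₁ h₂) h₃) h₄) h₅) h₆
  set Y := X c + X c + X a - (X d + X d + X b)
  set Z := (S + S + S + S + S + S) - (S + S + S + S + S + S)
  have hsub : ((B ×ˢ B).image fun x ↦ (c - d) * x.1 + ((a - b) + (c - d)) * x.2) ⊆ Y + Z := by
    intro y hy
    obtain ⟨⟨x, z⟩, hxz, rfl⟩ := Finset.mem_image.1 hy
    obtain ⟨hx, hz⟩ := Finset.mem_product.1 hxz
    obtain ⟨f₁, hf₁, u₁, hu₁, v₁, hv₁, e₁⟩ := hmem c hc x hx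
    obtain ⟨f₂, hf₂, u₂, hu₂, v₂, hv₂, e₂⟩ := hmem c hc z hz
    obtain ⟨f₃, hf₃, u₃, hu₃, v₃, hv₃, e₃⟩ := hmem a ha z hz
    obtain ⟨f₄, hf₄, u₄, hu₄, v₄, hv₄, e₄⟩ := hmem d hd x hx
    obtain ⟨f₅, hf₅, u₅, hu₅, v₅, hv₅, e₅⟩ := hmem d hd z hz
    obtain ⟨f₆, hf₆, u₆, hu₆, v₆, hv₆, e₆⟩ := hmem b hb z hz
    refine Finset.mem_add.2 ⟨f₁ + f₂ + f₃ - (f₄ + f₅ + f₆), ?_,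
      (u₁ + u₂ + u₃ + v₄ + v₅ + v₆) - (v₁ + v₂ + v₃ + u₄ + u₅ + u₆), ?_, ?_⟩
    · exact Finset.sub_mem_sub (Finset.add_mem_add (Finset.add_mem_add hf₁ hf₂) hf₃)
        (Finset.add_mem_add (Finset.add_mem_add hf₄ hf₅) hf₆)
    · exact Finset.sub_mem_sub (hsix hu₁ hu₂ hu₃ hv₄ hv₅ hv₆) (hsix hv₁ hv₂ hv₃ hu₄ hu₅ hu₆)
    · linear_combination e₁ + e₂ + e₃ - e₄ - e₅ - e₆
  have hY : (Y.card : ℝ) ≤ L ^ 6 := by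
    have h : Y.card ≤ (X c).card * (X c).card * (X a).card *
        ((X d).card * (X d).card * (X b).card) := by
      refine Finset.card_sub_le.trans (Nat.mul_le_mul ?_ ?_) <;>
      exact Finset.card_add_le.trans (Nat.mul_le_mul_right _ Finset.card_add_le)
    calc (Y.card : ℝ) ≤ (X c).card * (X c).card * (X a).card *
        ((X d).card * (X d).card * (X b).card) := by exact_mod_cast h
      _ ≤ L * L * L * (L * L * L) := by
        gcongr <;> apply hX <;> assumption
      _ = L ^ 6 := by ring
  calc _ ≤ ((Y + Z).card : ℝ) := by exact_mod_cast Finset.card_le_card hsub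
    _ ≤ Y.card * Z.card := by exact_mod_cast Finset.card_add_le
    _ ≤ _ := by
      gcongr
      exact Finset.card_six_add_sub_six_add_le hS hK

/-- Quantitative sum-product alternative for sets of nonzero elements. -/
theorem ZMod.card_le_or_le_of_card_add_le_of_card_mul_le {p : ℕ} [Fact p.Prime]
    {A : Finset (ZMod p)} (hA : A.Nonempty) (h0 : 0 ∉ A) {K : ℝ} (hK : 1 ≤ K)
    (hadd : ((A + A).card : ℝ) ≤ K * A.card) (hmul : ((A * A).card : ℝ) ≤ K * A.card) :
    (A.card : ℝ) ≤ 512 * K ^ 26 ∨ (p : ℝ) ≤ 128 * K ^ 24 * A.card := by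
  have hn : (0 : ℝ) < A.card := by exact_mod_cast hA.card_pos
  obtain ⟨b, hb, B, hBA, hB, hBt⟩ := Finset.exists_popular_dilate hA h0 (by linarith) hmul
  have hcard : ∀ t ∈ A, (t • A).card = A.card := fun t ht ↦
    Finset.card_smul_finset₀ (fun h ↦ h0 (h ▸ ht)) A
  have hdil : ∀ t ∈ A, ((t • A + t • A).card : ℝ) ≤ K * A.card := by
    intro t ht
    rw [← smul_add]
    exact (Nat.cast_le.2 Finset.card_image_le).trans hadd
  have hBne : B.Nonempty := by
    by_contra h
    rw [Finset.not_nonempty_iff_eq_empty] at h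
    simp [h] at hB
    simp [hB] at hn
  obtain ⟨a, ha, b', hb', c, hc, d, hd, hmin⟩ := ZMod.exists_min_card_sq_le_two_mul_card_image hBne
  have hup := Finset.card_image_le_of_subset_add_sub (S := b • A) (K := K) (L := 2 * K * K)
    hBA (hA.image _) (by positivity) (by rw [hcard b hb]; exact hdil b hb)
    (fun t ht ↦ Finset.exists_card_le_and_subset_add_sub_of_inter hA.card_pos
      (hdil t (hBA ht)) (hBt t ht) (by positivity)) ha hb' hc hd
  rw [hcard b hb] at hup
  have hmin' : min ((B.card : ℝ) ^ 2) p ≤ 128 * K ^ 24 * A.card := by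
    have h : min ((B.card : ℝ) ^ 2) p ≤ 2 * (((B ×ˢ B).image fun x ↦
        (c - d) * x.1 + ((a - b') + (c - d)) * x.2).card : ℝ) := by exact_mod_cast hmin
    linarith
  rcases min_le_iff.1 hmin' with h | h
  · left
    refine le_of_mul_le_mul_left ?_ hn
    calc (A.card : ℝ) * A.card ≤ (2 * K * B.card) * (2 * K * B.card) := by gcongr
      _ = 4 * K ^ 2 * (B.card : ℝ) ^ 2 := by ring
      _ ≤ 4 * K ^ 2 * (128 * K ^ 24 * A.card) := by gcongr
      _ = _ := by ring
  · exact .inr h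

/-- Sets of bounded size grow under addition, uniformly, unless they are the whole field. -/
theorem ZMod.exists_rpow_lt_card_add_self (N : ℝ) (hN : 2 ≤ N) :
    ∃ δ : ℝ, 0 < δ ∧ ∀ δ' ≤ δ, ∀ p : ℕ, p.Prime → ∀ A : Finset (ZMod p), 2 ≤ A.card →
      (A.card : ℝ) ≤ N → A.card < p → (A.card : ℝ) ^ (1 + δ') < (A + A).card := by
  have hN0 : 0 < N := by linarith
  have hlog : 0 < Real.logb N (1 + 1 / N) :=
    Real.logb_pos (by linarith) (by simpa using hN0)
  refine ⟨Real.logb N (1 + 1 / N) / 2, by positivity, fun δ' hδ' p hp A hA2 hAN hAp ↦ ?_⟩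
  have hA1 : (1 : ℝ) ≤ A.card := by exact_mod_cast (by omega : 1 ≤ A.card)
  have hA0 : (0 : ℝ) < A.card := by linarith
  have hne : A.Nonempty := Finset.card_pos.1 (by omega)
  have hcd : A.card + 1 ≤ (A + A).card :=
    (le_min (by omega) (by omega)).trans (ZMod.cauchy_davenport hp hne hne)
  calc (A.card : ℝ) ^ (1 + δ') = A.card * (A.card : ℝ) ^ δ' := by
        rw [Real.rpow_add hA0, Real.rpow_one]
    _ ≤ A.card * N ^ (Real.logb N (1 + 1 / N) / 2) := by
        gcongr
        exact (Real.rpow_le_rpow_of_exponent_le hA1 hδ').trans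
          (Real.rpow_le_rpow hA0.le hAN (by positivity))
    _ < A.card * N ^ Real.logb N (1 + 1 / N) := by
        exact mul_lt_mul_of_pos_left
          (Real.rpow_lt_rpow_of_exponent_lt (by linarith) (by linarith)) hA0
    _ = A.card * (1 + 1 / N) := by
        rw [Real.rpow_logb hN0 (by linarith) (by positivity)]
    _ = A.card + A.card / N := by ring
    _ ≤ A.card + 1 := by
        gcongr
        exact (div_le_one hN0).2 hAN
    _ ≤ (A + A).card := by exact_mod_cast hcd

/-- `ZMod.card_le_or_le_of_card_add_le_of_card_mul_le` for sets that may contain zero. -/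
theorem ZMod.card_le_or_le_of_card_add_le_of_card_mul_le_of_two_le {p : ℕ} [Fact p.Prime]
    {A : Finset (ZMod p)} (hA : 2 ≤ A.card) {K : ℝ} (hK : 1 ≤ K)
    (hadd : ((A + A).card : ℝ) ≤ K * A.card) (hmul : ((A * A).card : ℝ) ≤ K * A.card) :
    (A.card : ℝ) ≤ 2 ^ 36 * K ^ 26 ∨ (p : ℝ) ≤ 2 ^ 36 * K ^ 24 * A.card := by
  have hsub : A.erase 0 ⊆ A := Finset.erase_subset _ _
  have hhalf : A.card ≤ 2 * (A.erase 0).card := by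
    have := Finset.pred_card_le_card_erase (s := A) (a := 0)
    omega
  have hhalf' : (A.card : ℝ) ≤ 2 * (A.erase 0).card := by exact_mod_cast hhalf
  have hle : ((A.erase 0).card : ℝ) ≤ A.card := by exact_mod_cast Finset.card_le_card hsub
  have hadd' : ((A.erase 0 + A.erase 0).card : ℝ) ≤ 2 * K * (A.erase 0).card := by
    have : ((A.erase 0 + A.erase 0).card : ℝ) ≤ (A + A).card := by
      exact_mod_cast Finset.card_le_card (Finset.add_subset_add hsub hsub)
    nlinarith
  have hmul' : ((A.erase 0 * A.erase 0).card : ℝ) ≤ 2 * K * (A.erase 0).card := by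
    have : ((A.erase 0 * A.erase 0).card : ℝ) ≤ (A * A).card := by
      exact_mod_cast Finset.card_le_card (Finset.mul_subset_mul hsub hsub)
    nlinarith
  rcases ZMod.card_le_or_le_of_card_add_le_of_card_mul_le (Finset.card_pos.1 (by omega))
    (Finset.notMem_erase 0 A) (by linarith : 1 ≤ 2 * K) hadd' hmul' with h | h
  · left
    calc (A.card : ℝ) ≤ 2 * (512 * (2 * K) ^ 26) := by linarith
      _ = 2 ^ 36 * K ^ 26 := by ring
  · right
    calc (p : ℝ) ≤ 128 * (2 * K) ^ 24 * (A.erase 0).card := h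
      _ ≤ 128 * (2 * K) ^ 24 * A.card := by gcongr
      _ = 2 ^ 31 * (K ^ 24 * A.card) := by ring
      _ ≤ 2 ^ 36 * (K ^ 24 * A.card) := by gcongr <;> norm_num
      _ = _ := by ring

/-- A set that does not grow under addition and multiplication, and is not almost the whole field,
has bounded size. -/
theorem ZMod.card_le_of_card_add_le_rpow_of_card_mul_le_rpow {ε δ : ℝ} (hε : 0 < ε)
    (hδ1 : 52 * δ ≤ 1) (hδε : 48 * δ ≤ ε) (hδ : 0 ≤ δ) {p : ℕ} (hp : p.Prime)
    {A : Finset (ZMod p)} (hA : 2 ≤ A.card)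
    (hadd : ((A + A).card : ℝ) ≤ (A.card : ℝ) ^ (1 + δ))
    (hmul : ((A * A).card : ℝ) ≤ (A.card : ℝ) ^ (1 + δ))
    (hAp : (A.card : ℝ) ≤ (p : ℝ) ^ (1 - ε)) :
    (A.card : ℝ) ≤ max ((2 ^ 36) ^ 2) ((2 ^ 36) ^ (2 / ε)) := by
  have := Fact.mk hp
  have hA1 : (1 : ℝ) ≤ A.card := by exact_mod_cast (by omega : 1 ≤ A.card)
  have hA0 : (0 : ℝ) < A.card := by linarith
  have hp1 : (1 : ℝ) ≤ p := by exact_mod_cast hp.one_lt.le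
  have hp0 : (0 : ℝ) < p := by linarith
  have hcardp : (A.card : ℝ) ≤ p := by
    have := Finset.card_le_univ A
    rw [ZMod.card] at this
    exact_mod_cast this
  have hpow : (A.card : ℝ) ^ (1 + δ) = (A.card : ℝ) ^ δ * A.card := by
    rw [add_comm, Real.rpow_add hA0, Real.rpow_one]
  rw [hpow] at hadd hmul
  rcases ZMod.card_le_or_le_of_card_add_le_of_card_mul_le_of_two_le hA
    (Real.one_le_rpow hA1 hδ) hadd hmul with h | h
  · refine le_max_of_le_left ?_
    rw [← Real.rpow_mul_natCast hA0.le] at h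
    have h2 : (A.card : ℝ) ^ (δ * (26 : ℕ)) ≤ Real.sqrt A.card := by
      rw [Real.sqrt_eq_rpow]
      exact Real.rpow_le_rpow_of_exponent_le hA1 (by push_cast; linarith)
    have hs : 0 < Real.sqrt A.card := Real.sqrt_pos.2 hA0
    have hss := Real.mul_self_sqrt hA0.le
    have h3 : Real.sqrt A.card ≤ 2 ^ 36 := by
      refine le_of_mul_le_mul_right ?_ hs
      rw [hss]
      exact h.trans (by gcongr)
    calc (A.card : ℝ) = Real.sqrt A.card ^ 2 := by rw [sq, hss]
      _ ≤ _ := by gcongr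
  · refine le_max_of_le_right (hcardp.trans ?_)
    rw [← Real.rpow_mul_natCast hA0.le] at h
    have h2 : (A.card : ℝ) ^ (δ * (24 : ℕ)) ≤ (p : ℝ) ^ (ε / 2) :=
      (Real.rpow_le_rpow hA0.le hcardp (by positivity)).trans
        (Real.rpow_le_rpow_of_exponent_le hp1 (by push_cast; linarith))
    have h3 : (p : ℝ) ^ (ε / 2) ≤ 2 ^ 36 := by
      refine le_of_mul_le_mul_right ?_ (Real.rpow_pos_of_pos hp0 (1 - ε / 2))
      calc (p : ℝ) ^ (ε / 2) * (p : ℝ) ^ (1 - ε / 2) = p := by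
            rw [← Real.rpow_add hp0]
            simp
        _ ≤ 2 ^ 36 * (p : ℝ) ^ (ε / 2) * (p : ℝ) ^ (1 - ε) := h.trans (by gcongr)
        _ = 2 ^ 36 * (p : ℝ) ^ (1 - ε / 2) := by
            rw [mul_assoc, ← Real.rpow_add hp0]
            ring_nf
    calc (p : ℝ) = ((p : ℝ) ^ (ε / 2)) ^ (2 / ε) := by
          rw [← Real.rpow_mul hp0.le]
          field_simp
          simp
      _ ≤ _ := Real.rpow_le_rpow (by positivity) h3 (by positivity)

/-- **Sum-product theorem** (Bourgain–Katz–Tao, Bourgain–Glibichuk–Konyagin).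
For every `ε > 0` there is `δ > 0` such that for every prime `p` and every subset
`A` of `𝔽_p` with `|A| ≥ 2`, either `|A+A| > |A|^(1+δ)`, or `|A·A| > |A|^(1+δ)`,
or `|A| > p^(1-ε)`. -/
theorem sum_product_theorem :
    ∀ ε : ℝ, 0 < ε → ∃ δ : ℝ, 0 < δ ∧
      ∀ (p : ℕ), p.Prime → ∀ A : Finset (ZMod p), 2 ≤ A.card →
        ((A + A).card : ℝ) > (A.card : ℝ) ^ ((1 : ℝ) + δ) ∨
        ((A * A).card : ℝ) > (A.card : ℝ) ^ ((1 : ℝ) + δ) ∨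
        (A.card : ℝ) > (p : ℝ) ^ ((1 : ℝ) - ε) := by
  intro ε hε
  set N : ℝ := max ((2 ^ 36) ^ 2) ((2 ^ 36) ^ (2 / ε))
  obtain ⟨δ₁, hδ₁, hsmall⟩ := ZMod.exists_rpow_lt_card_add_self N
    (le_max_of_le_left (by norm_num))
  refine ⟨min δ₁ (min (1 / 52) (ε / 48)), by positivity, fun p hp A hA ↦ ?_⟩
  set δ := min δ₁ (min (1 / 52) (ε / 48))
  have hδ : 0 < δ := by positivity
  have h52 : δ ≤ 1 / 52 := (min_le_right _ _).trans (min_le_left _ _)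
  have h48 : δ ≤ ε / 48 := (min_le_right _ _).trans (min_le_right _ _)
  by_contra! h
  obtain ⟨hadd, hmul, hAp⟩ := h
  have hp1 : (1 : ℝ) < p := by exact_mod_cast hp.one_lt
  have hlt : (A.card : ℝ) < p :=
    hAp.trans_lt (Real.rpow_lt_self_of_one_lt hp1 (by linarith))
  have hN := ZMod.card_le_of_card_add_le_rpow_of_card_mul_le_rpow hε (by linarith)
    (by linarith) hδ.le hp hA hadd hmul hAp
  exact (hsmall δ (min_le_left _ _) p hp A hA hN (by exact_mod_cast hlt)).not_ge hadd
end

section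
/- There is an absolute constant c > 0 such that for every K ≥ 1 there exists C(K) > 0 with the following property: every finite nonempty subset A ⊆ ℤ with |A+A| ≤ K|A| is C(K)-commensurable to a d-dimensional arithmetic progression P ⊆ ℤ with d ≤ c·(1 + log K). -/
open Pointwise

/-- The points of `Λ` of sup norm at most `r`. -/
def latticeBall {d : ℕ} (Λ : AddSubgroup (Fin d → ℝ)) (r : ℝ) : Set (Fin d → ℝ) :=
  {x | x ∈ Λ ∧ ‖x‖ ≤ r}

/-- A subgroup of `ℝ^d` is locally finite if it has finitely many points in every ball. -/
def IsLocallyFinite {d : ℕ} (Λ : AddSubgroup (Fin d → ℝ)) : Prop :=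
  ∀ r : ℝ, (latticeBall Λ r).Finite

theorem exists_cover_of_bounded {d : ℕ} {H : Type*} (f : H → Fin d → ℝ) (m : ℕ) {s : ℝ}
    (hs : 0 < s) :
    ∃ X : Finset H, X.card ≤ (2 * m + 1) ^ d ∧ (∀ y ∈ X, ‖f y‖ ≤ m * s) ∧
      ∀ h, ‖f h‖ ≤ m * s → ∃ y ∈ X, ‖f h - f y‖ ≤ s := by
  classical
  set cell : H → Fin d → ℤ := fun h i => ⌊f h i / s⌋
  set cells : Finset (Fin d → ℤ) := Fintype.piFinset fun _ => Finset.Icc (-(m : ℤ)) m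
  have hcell : ∀ h, ‖f h‖ ≤ m * s → cell h ∈ cells := by
    intro h hh
    rw [Fintype.mem_piFinset]
    intro i
    have h1 : |f h i| ≤ m * s := (norm_le_pi_norm (f h) i).trans hh
    rw [abs_le] at h1
    rw [Finset.mem_Icc, Int.le_floor]
    constructor
    · rw [le_div_iff₀ hs]; push_cast; linarith
    · have : f h i / s ≤ (m : ℤ) := by rw [div_le_iff₀ hs]; push_cast; linarith
      exact Int.floor_le_iff.2 (by linarith)
  set good : Finset (Fin d → ℤ) := cells.filter fun c => ∃ h, ‖f h‖ ≤ m * s ∧ cell h = c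
  have hgood : ∀ c : good, ∃ h, ‖f h‖ ≤ m * s ∧ cell h = c := fun c =>
    (Finset.mem_filter.1 c.2).2
  choose rep hrep1 hrep2 using hgood
  refine ⟨good.attach.image rep, ?_, ?_, ?_⟩
  · refine Finset.card_image_le.trans ?_
    rw [Finset.card_attach]
    refine (Finset.card_filter_le _ _).trans ?_
    simp only [cells, Fintype.card_piFinset, Int.card_Icc, Finset.prod_const, Finset.card_univ,
      Fintype.card_fin]
    apply le_of_eq
    congr 1
    omega
  · intro y hy
    obtain ⟨c, -, rfl⟩ := Finset.mem_image.1 hy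
    exact hrep1 c
  · intro h hh
    have hmem : cell h ∈ good := Finset.mem_filter.2 ⟨hcell h hh, h, hh, rfl⟩
    refine ⟨rep ⟨_, hmem⟩, Finset.mem_image_of_mem _ (Finset.mem_attach _ _), ?_⟩
    rw [pi_norm_le_iff_of_nonneg hs.le]
    intro i
    have h1 : ⌊f (rep ⟨_, hmem⟩) i / s⌋ = ⌊f h i / s⌋ := congrFun (hrep2 ⟨_, hmem⟩) i
    have h2 := Int.abs_sub_lt_one_of_floor_eq_floor h1
    rw [← sub_div, abs_div, abs_of_pos hs, div_lt_one hs, abs_sub_comm] at h2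
    exact h2.le

theorem ncard_latticeBall_mul_le {d : ℕ} {Λ : AddSubgroup (Fin d → ℝ)} (hΛ : IsLocallyFinite Λ)
    (m : ℕ) {s : ℝ} (hs : 0 < s) :
    (latticeBall Λ (m * s)).ncard ≤ (2 * m + 1) ^ d * (latticeBall Λ s).ncard := by
  classical
  obtain ⟨X, hX, -, hcov⟩ := exists_cover_of_bounded (fun x : Λ => (x : Fin d → ℝ)) m hs
  have hsub : latticeBall Λ (m * s) ⊆
      ((X.image fun x : Λ => (x : Fin d → ℝ)) + (hΛ s).toFinset : Finset (Fin d → ℝ)) := by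
    rintro y ⟨hy, hy'⟩
    obtain ⟨x, hx, hxy⟩ := hcov ⟨y, hy⟩ hy'
    rw [Finset.mem_coe, Finset.mem_add]
    refine ⟨x, Finset.mem_image_of_mem _ hx, y - x, ?_, by abel⟩
    rw [Set.Finite.mem_toFinset]
    exact ⟨Λ.sub_mem hy x.2, hxy⟩
  refine (Set.ncard_le_ncard hsub (Finset.finite_toSet _)).trans ?_
  rw [Set.ncard_coe_finset]
  refine Finset.card_add_le.trans ?_
  rw [Set.ncard_eq_toFinset_card _ (hΛ s)]
  exact Nat.mul_le_mul_right _ (Finset.card_image_le.trans hX)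

/-- Projection of `ℝ^(d+1)` along a nonzero vector `v` onto a coordinate hyperplane in whose
complementary direction `v` has its largest coordinate. -/
theorem exists_projection {d : ℕ} {v : Fin (d + 1) → ℝ} (hv : v ≠ 0) :
    ∃ T : (Fin (d + 1) → ℝ) →ₗ[ℝ] (Fin d → ℝ), T v = 0 ∧ (∀ x, ‖T x‖ ≤ 2 * ‖x‖) ∧
      (∀ x, T x = 0 → ∃ t : ℝ, x = t • v) ∧
      ∀ x, ∃ n : ℤ, ‖x + n • v‖ ≤ ‖T x‖ + ‖v‖ / 2 := by
  obtain ⟨i₀, hi₀⟩ : ∃ i₀, ‖v i₀‖ = ‖v‖ := by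
    obtain ⟨i, -, hi⟩ := Finset.exists_mem_eq_sup' (Finset.univ_nonempty) (fun i => ‖v i‖₊)
    refine ⟨i, ?_⟩
    rw [Pi.norm_def, ← Finset.sup'_eq_sup Finset.univ_nonempty, hi, coe_nnnorm]
  have hpos : 0 < ‖v‖ := norm_pos_iff.2 hv
  have hne : v i₀ ≠ 0 := by rw [← norm_pos_iff, hi₀]; exact hpos
  have hratio : ∀ j, |v j / v i₀| ≤ 1 := by
    intro j
    rw [abs_div, ← Real.norm_eq_abs, ← Real.norm_eq_abs, hi₀, div_le_one hpos]
    exact norm_le_pi_norm v j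
  let T : (Fin (d + 1) → ℝ) →ₗ[ℝ] (Fin d → ℝ) :=
    { toFun := fun x j => x (i₀.succAbove j) - v (i₀.succAbove j) / v i₀ * x i₀
      map_add' := by intro x y; ext j; simp only [Pi.add_apply]; ring
      map_smul' := by
        intro c x; ext j; simp only [Pi.smul_apply, smul_eq_mul, RingHom.id_apply]; ring }
  have hT : ∀ x j, T x j = x (i₀.succAbove j) - v (i₀.succAbove j) / v i₀ * x i₀ :=
    fun x j => rfl
  have hTv : T v = 0 := by
    ext j; rw [hT, div_mul_cancel₀ _ hne, sub_self]; rfl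
  refine ⟨T, hTv, ?_, ?_, ?_⟩
  · intro x
    rw [pi_norm_le_iff_of_nonneg (by positivity)]
    intro j
    rw [hT, Real.norm_eq_abs]
    have h1 : |x (i₀.succAbove j)| ≤ ‖x‖ := norm_le_pi_norm x _
    have h2 : |x i₀| ≤ ‖x‖ := norm_le_pi_norm x _
    calc |x (i₀.succAbove j) - v (i₀.succAbove j) / v i₀ * x i₀|
        ≤ |x (i₀.succAbove j)| + |v (i₀.succAbove j) / v i₀ * x i₀| := abs_sub _ _
      _ ≤ ‖x‖ + 1 * ‖x‖ := by
        rw [abs_mul]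
        exact add_le_add h1 (mul_le_mul (hratio _) h2 (abs_nonneg _) zero_le_one)
      _ = 2 * ‖x‖ := by ring
  · intro x hx
    refine ⟨x i₀ / v i₀, ?_⟩
    ext j
    rcases Fin.eq_self_or_eq_succAbove i₀ j with rfl | ⟨k, rfl⟩
    · simp [div_mul_cancel₀ _ hne]
    · have := congrFun hx k
      rw [hT, Pi.zero_apply, sub_eq_zero] at this
      rw [this, Pi.smul_apply, smul_eq_mul]
      ring
  · intro x
    set n : ℤ := -round (x i₀ / v i₀)
    refine ⟨n, ?_⟩
    have hcoord : |(x + n • v) i₀| ≤ ‖v‖ / 2 := by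
      have h1 : (x + n • v) i₀ = (x i₀ / v i₀ - round (x i₀ / v i₀)) * v i₀ := by
        rw [Pi.add_apply, Pi.smul_apply, zsmul_eq_mul]
        simp only [n]
        push_cast
        field_simp
        ring
      rw [h1, abs_mul, ← Real.norm_eq_abs (v i₀), hi₀]
      have := abs_sub_round (x i₀ / v i₀)
      nlinarith
    rw [pi_norm_le_iff_of_nonneg (by positivity)]
    intro j
    rw [Real.norm_eq_abs]
    rcases Fin.eq_self_or_eq_succAbove i₀ j with rfl | ⟨k, rfl⟩
    · linarith [norm_nonneg (T x)]
    · have hTx : T (x + n • v) = T x := by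
        rw [map_add, map_zsmul, hTv, smul_zero, add_zero]
      have h1 : (x + n • v) (i₀.succAbove k) =
          T x k + v (i₀.succAbove k) / v i₀ * (x + n • v) i₀ := by
        rw [← hTx, hT]; ring
      have h2 : |T x k| ≤ ‖T x‖ := norm_le_pi_norm (T x) k
      rw [h1]
      refine (abs_add_le _ _).trans (add_le_add h2 ?_)
      rw [abs_mul]
      calc _ ≤ 1 * |(x + n • v) i₀| :=
            mul_le_mul_of_nonneg_right (hratio _) (abs_nonneg _)
        _ ≤ _ := by linarith

theorem IsLocallyFinite.map {d e : ℕ} {Λ : AddSubgroup (Fin d → ℝ)} (hΛ : IsLocallyFinite Λ)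
    {T : (Fin d → ℝ) →+ (Fin e → ℝ)} {c : ℝ}
    (hT : ∀ x ∈ Λ, ∃ y ∈ Λ, T y = T x ∧ ‖y‖ ≤ ‖T x‖ + c) : IsLocallyFinite (Λ.map T) := by
  intro r
  refine ((hΛ (r + c)).image T).subset ?_
  rintro _ ⟨⟨x, hx, rfl⟩, hr⟩
  obtain ⟨y, hy, hyx, hn⟩ := hT x hx
  exact ⟨y, ⟨hy, by linarith⟩, hyx⟩

theorem card_parallel_le {d : ℕ} {Λ : AddSubgroup (Fin d → ℝ)} {v : Fin d → ℝ}
    (hvΛ : v ∈ Λ) (hv : v ≠ 0) (hmin : ∀ x ∈ Λ, x ≠ 0 → ‖v‖ ≤ ‖x‖) {r : ℝ}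
    {F : Finset (Fin d → ℝ)} (hF : ∀ x ∈ F, x ∈ latticeBall Λ r)
    (hpar : ∀ x ∈ F, ∀ y ∈ F, ∃ t : ℝ, x - y = t • v) :
    F.card ≤ 9 * (2 * ⌊r / (2 * ‖v‖)⌋₊ + 1) := by
  classical
  have hpos : 0 < ‖v‖ := norm_pos_iff.2 hv
  rcases F.eq_empty_or_nonempty with rfl | ⟨y, hy⟩
  · simp
  have hr : 0 ≤ r := (norm_nonneg y).trans (hF y hy).2
  set q := r / (2 * ‖v‖) with hq
  have hq0 : 0 ≤ q := by positivity
  have hint : ∀ x ∈ F, ∃ n : ℤ, x - y = n • v := by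
    intro x hx
    obtain ⟨t, ht⟩ := hpar x hx y hy
    refine ⟨round t, ?_⟩
    by_contra hne
    have hmem : x - y - round t • v ∈ Λ :=
      Λ.sub_mem (Λ.sub_mem (hF x hx).1 (hF y hy).1) (Λ.zsmul_mem hvΛ _)
    have h1 := hmin _ hmem (sub_ne_zero.2 hne)
    have h2 : x - y - round t • v = (t - round t) • v := by
      rw [ht, sub_smul, Int.cast_smul_eq_zsmul]
    rw [h2, norm_smul, Real.norm_eq_abs] at h1
    nlinarith [abs_sub_round t]
  choose! n hn using hint
  have hmaps : ∀ x ∈ F, n x ∈ Finset.Icc (-((4 * ⌊q⌋₊ + 3 : ℕ) : ℤ)) ((4 * ⌊q⌋₊ + 3 : ℕ) : ℤ) := by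
    intro x hx
    have h1 : ‖x - y‖ ≤ 2 * r := by
      refine (norm_sub_le _ _).trans ?_
      linarith [(hF x hx).2, (hF y hy).2]
    rw [hn x hx, ← Int.cast_smul_eq_zsmul ℝ, norm_smul, Real.norm_eq_abs] at h1
    have h2 : |(n x : ℝ)| ≤ 4 * q := by
      rw [hq, mul_div_assoc', le_div_iff₀ (by positivity)]
      linarith
    have h3 := Nat.lt_floor_add_one q
    have h4 : |n x| < 4 * (⌊q⌋₊ : ℤ) + 4 := by
      have : (|n x| : ℝ) < 4 * (⌊q⌋₊ : ℝ) + 4 := by linarith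
      exact_mod_cast this
    rw [Finset.mem_Icc]
    have := abs_lt.1 h4
    push_cast
    omega
  have hinj : Set.InjOn n F := by
    intro x hx x' hx' h
    have h1 := hn x hx
    rw [h, ← hn x' hx'] at h1
    exact sub_left_injective h1
  have := Finset.card_le_card_of_injOn n hmaps hinj
  rw [Int.card_Icc] at this
  omega

/-- The points of norm at most `r` in a locally finite subgroup of `ℝ^d` are, up to a constant
factor, no more numerous than those of a proper box all of whose side lengths are at least `M`. -/
theorem exists_box_in_latticeBall (M d : ℕ) :
    ∃ C : ℕ, ∀ Λ : AddSubgroup (Fin d → ℝ), IsLocallyFinite Λ → ∀ r : ℝ, 0 < r →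
      ∃ (k : ℕ) (v : Fin k → Fin d → ℝ) (ℓ : Fin k → ℕ), k ≤ d ∧ (∀ i, v i ∈ Λ) ∧
        (∀ i, M ≤ ℓ i) ∧ ∑ i, ℓ i * ‖v i‖ ≤ r ∧
        (∀ n : Fin k → ℤ, ∑ i, n i • v i = 0 → n = 0) ∧
        (latticeBall Λ r).ncard ≤ C * ∏ i, (2 * ℓ i + 1) := by
  classical
  induction d with
  | zero =>
    refine ⟨1, fun Λ hΛ r hr => ⟨0, Fin.elim0, Fin.elim0, le_rfl, fun i => i.elim0,
      fun i => i.elim0, by simpa using hr.le, fun n _ => Subsingleton.elim _ _, ?_⟩⟩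
    simpa using Set.ncard_le_one_of_subsingleton (latticeBall Λ r)
  | succ d ih =>
    obtain ⟨C, hC⟩ := ih
    refine ⟨9 * (17 ^ d * C) * (2 * M + 1) + 1, fun Λ hΛ r hr => ?_⟩
    by_cases hex : ∃ x ∈ Λ, x ≠ 0
    swap
    · push Not at hex
      refine ⟨0, Fin.elim0, Fin.elim0, Nat.zero_le _, fun i => i.elim0,
        fun i => i.elim0, by simpa using hr.le, fun n _ => Subsingleton.elim _ _, ?_⟩
      have : latticeBall Λ r ⊆ {0} := fun x hx => hex x hx.1
      have := Set.ncard_le_ncard this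
      rw [Set.ncard_singleton] at this
      simp only [Finset.univ_eq_empty, Finset.prod_empty, mul_one]
      omega
    obtain ⟨v, hvΛ, hv0, hmin⟩ : ∃ v ∈ Λ, v ≠ 0 ∧ ∀ x ∈ Λ, x ≠ 0 → ‖v‖ ≤ ‖x‖ := by
      obtain ⟨x, hxΛ, hx0⟩ := hex
      obtain ⟨v, hv, hvmin⟩ := Set.exists_min_image (latticeBall Λ ‖x‖ \ {0}) (fun y => ‖y‖)
        ((hΛ ‖x‖).subset Set.sdiff_subset) ⟨x, ⟨hxΛ, le_rfl⟩, hx0⟩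
      refine ⟨v, hv.1.1, hv.2, fun y hy hy0 => ?_⟩
      by_cases h : ‖y‖ ≤ ‖x‖
      · exact hvmin y ⟨⟨hy, h⟩, hy0⟩
      · exact hv.1.2.trans (not_le.1 h).le
    have hpos : 0 < ‖v‖ := norm_pos_iff.2 hv0
    obtain ⟨T, hTv, hT2, hTker, hTlift⟩ := exists_projection hv0
    have hlift : ∀ x ∈ Λ, ∃ y ∈ Λ, T y = T x ∧ ‖y‖ ≤ ‖T x‖ + ‖v‖ / 2 := by
      intro x hx
      obtain ⟨n, hn⟩ := hTlift x
      refine ⟨x + n • v, Λ.add_mem hx (Λ.zsmul_mem hvΛ n), ?_, hn⟩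
      rw [map_add, map_zsmul, hTv, smul_zero, add_zero]
    set Λ' := Λ.map (T : (Fin (d + 1) → ℝ) →+ (Fin d → ℝ)) with hΛ'
    have hfin' : IsLocallyFinite Λ' := hΛ.map hlift
    obtain ⟨k, w, ℓ, hk, hwΛ, hℓM, hsum, hind, hcard⟩ := hC Λ' hfin' (r / 4) (by linarith)
    have hw : ∀ i, ∃ u ∈ Λ, T u = w i ∧ ‖u‖ ≤ ‖w i‖ + ‖v‖ / 2 := by
      intro i
      obtain ⟨x, hx, hxw⟩ := hwΛ i
      obtain ⟨y, hy, hyx, hn⟩ := hlift x hx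
      have : T x = w i := hxw
      exact ⟨y, hy, hyx.trans this, this ▸ hn⟩
    choose u huΛ huw hun using hw
    have hw0 : ∀ i, w i ≠ 0 := by
      intro i hi
      have := congrFun (hind (Pi.single i 1) (by
        rw [Finset.sum_eq_single i]
        · simp [hi]
        · intro j _ hj; simp [hj]
        · simp)) i
      simp at this
    have hun2 : ∀ i, ‖u i‖ ≤ 2 * ‖w i‖ := by
      intro i
      have h0 : u i ≠ 0 := fun h => hw0 i (by rw [← huw, h, map_zero])
      linarith [hmin _ (huΛ i) h0, hun i]
    have husum : ∑ i, ℓ i * ‖u i‖ ≤ r / 2 := by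
      calc ∑ i, (ℓ i : ℝ) * ‖u i‖ ≤ ∑ i, 2 * ((ℓ i : ℝ) * ‖w i‖) := by
            refine Finset.sum_le_sum fun i _ => ?_
            nlinarith [hun2 i, (Nat.cast_nonneg (ℓ i) : (0 : ℝ) ≤ ℓ i)]
        _ ≤ r / 2 := by rw [← Finset.mul_sum]; linarith
    set q := ⌊r / (2 * ‖v‖)⌋₊ with hq
    have hqv : (q : ℝ) * ‖v‖ ≤ r / 2 := by
      have := Nat.floor_le (show 0 ≤ r / (2 * ‖v‖) by positivity)
      calc (q : ℝ) * ‖v‖ ≤ r / (2 * ‖v‖) * ‖v‖ := mul_le_mul_of_nonneg_right this hpos.le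
        _ = r / 2 := by field_simp
    have huind : ∀ n : Fin k → ℤ, ∀ m : ℤ, m • v + ∑ i, n i • u i = 0 → m = 0 ∧ n = 0 := by
      intro n m h
      have h1 := congrArg T h
      simp only [map_add, map_sum, map_zsmul, hTv, smul_zero, zero_add, map_zero, huw] at h1
      have hn := hind n h1
      refine ⟨?_, hn⟩
      subst hn
      simp only [Pi.zero_apply, zero_smul, Finset.sum_const_zero, add_zero] at h
      exact (smul_eq_zero.1 h).resolve_right hv0
    have hcount : (latticeBall Λ r).ncard ≤
        9 * (17 ^ d * C) * (2 * q + 1) * ∏ i, (2 * ℓ i + 1) := by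
      rw [Set.ncard_eq_toFinset_card _ (hΛ r)]
      have h1 : (hΛ r).toFinset.card ≤ 9 * (2 * q + 1) * ((hΛ r).toFinset.image T).card := by
        refine Finset.card_le_mul_card_image _ _ fun b _ => ?_
        refine card_parallel_le hvΛ hv0 hmin (fun x hx => ?_) fun x hx y hy => ?_
        · exact (hΛ r).mem_toFinset.1 (Finset.mem_filter.1 hx).1
        · refine hTker _ ?_
          rw [map_sub, (Finset.mem_filter.1 hx).2, (Finset.mem_filter.1 hy).2, sub_self]
      have h2 : ((hΛ r).toFinset.image T).card ≤ (latticeBall Λ' ((8 : ℕ) * (r / 4))).ncard := by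
        rw [Set.ncard_eq_toFinset_card _ (hfin' _)]
        refine Finset.card_le_card fun y hy => ?_
        obtain ⟨x, hx, rfl⟩ := Finset.mem_image.1 hy
        rw [Set.Finite.mem_toFinset] at hx ⊢
        refine ⟨⟨x, hx.1, rfl⟩, (hT2 x).trans ?_⟩
        have := hx.2
        push_cast
        linarith
      have h3 := ncard_latticeBall_mul_le hfin' 8 (show 0 < r / 4 by linarith)
      calc _ ≤ 9 * (2 * q + 1) * ((2 * 8 + 1) ^ d * (C * ∏ i, (2 * ℓ i + 1))) :=
            h1.trans (Nat.mul_le_mul_left _ (h2.trans (h3.trans (Nat.mul_le_mul_left _ hcard))))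
        _ = _ := by ring
    by_cases hqM : M ≤ q
    · refine ⟨k + 1, Fin.cons v u, Fin.cons q ℓ, Nat.succ_le_succ hk, ?_, ?_, ?_, ?_, ?_⟩
      · exact fun i => Fin.cases hvΛ huΛ i
      · exact fun i => Fin.cases hqM hℓM i
      · rw [Fin.sum_univ_succ]
        simp only [Fin.cons_zero, Fin.cons_succ]
        linarith
      · intro n hn
        rw [Fin.sum_univ_succ] at hn
        simp only [Fin.cons_zero, Fin.cons_succ] at hn
        obtain ⟨h0, h1⟩ := huind (fun i => n i.succ) (n 0) hn
        ext i
        exact Fin.cases h0 (fun j => congrFun h1 j) i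
      · rw [Fin.prod_univ_succ]
        simp only [Fin.cons_zero, Fin.cons_succ]
        refine hcount.trans ?_
        have hM : 9 * (17 ^ d * C) ≤ 9 * (17 ^ d * C) * (2 * M + 1) + 1 :=
          (Nat.le_mul_of_pos_right _ (by omega)).trans (Nat.le_succ _)
        calc _ ≤ (9 * (17 ^ d * C) * (2 * M + 1) + 1) * (2 * q + 1) * ∏ i, (2 * ℓ i + 1) :=
              Nat.mul_le_mul_right _ (Nat.mul_le_mul_right _ hM)
          _ = _ := mul_assoc _ _ _
    · refine ⟨k, u, ℓ, hk.trans (Nat.le_succ d), huΛ, hℓM, by linarith, ?_, ?_⟩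
      · intro n hn
        exact (huind n 0 (by rw [zero_smul, zero_add, hn])).2
      · refine hcount.trans (Nat.mul_le_mul_right _ ?_)
        refine (Nat.mul_le_mul_left _ (show 2 * q + 1 ≤ 2 * M + 1 by omega)).trans (Nat.le_succ _)

section Reduction

variable {H : Type*} [AddCommGroup H] {d : ℕ}

/-- The image in `ℤ` of the elements whose position in `ℝ^d` has norm at most `r`. -/
def latticeImage (θ : H →+ (Fin d → ℝ)) (π : H →+ ℤ) (r : ℝ) : Set ℤ :=
  π '' {h | ‖θ h‖ ≤ r}

theorem exists_subset_image_latticeBall {θ : H →+ (Fin d → ℝ)} {π : H →+ ℤ}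
    (hker : ∀ h, θ h = 0 → π h = 0) (r : ℝ) :
    ∃ f : (Fin d → ℝ) → ℤ, latticeImage θ π r ⊆ f '' latticeBall θ.range r := by
  classical
  choose σ hσ using fun x : θ.range => x.2
  refine ⟨fun x => if hx : x ∈ θ.range then π (σ ⟨x, hx⟩) else 0, ?_⟩
  rintro _ ⟨h, hh, rfl⟩
  refine ⟨θ h, ⟨⟨h, rfl⟩, hh⟩, ?_⟩
  have hx : θ h ∈ θ.range := ⟨h, rfl⟩
  simp only [dif_pos hx]
  rw [← sub_eq_zero, ← map_sub]
  exact hker _ (by rw [map_sub, hσ, sub_self])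

theorem finite_latticeImage {θ : H →+ (Fin d → ℝ)} {π : H →+ ℤ}
    (hfin : IsLocallyFinite θ.range) (hker : ∀ h, θ h = 0 → π h = 0) (r : ℝ) :
    (latticeImage θ π r).Finite := by
  obtain ⟨f, hf⟩ := exists_subset_image_latticeBall hker r
  exact ((hfin r).image f).subset hf

theorem ncard_latticeImage_le {θ : H →+ (Fin d → ℝ)} {π : H →+ ℤ}
    (hfin : IsLocallyFinite θ.range) (hker : ∀ h, θ h = 0 → π h = 0) (r : ℝ) :
    (latticeImage θ π r).ncard ≤ (latticeBall θ.range r).ncard := by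
  obtain ⟨f, hf⟩ := exists_subset_image_latticeBall hker r
  exact (Set.ncard_le_ncard hf ((hfin r).image f)).trans (Set.ncard_image_le (hfin r))

theorem exists_cover_latticeImage (θ : H →+ (Fin d → ℝ)) (π : H →+ ℤ) (m : ℕ) :
    ∃ X : Finset ℤ, X.card ≤ (2 * m + 1) ^ d ∧
      latticeImage θ π m ⊆ (X : Set ℤ) + latticeImage θ π 1 := by
  classical
  obtain ⟨X, hX, -, hcov⟩ := exists_cover_of_bounded θ m one_pos
  refine ⟨X.image π, Finset.card_image_le.trans hX, ?_⟩
  rintro _ ⟨h, hh, rfl⟩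
  obtain ⟨x, hx, hxh⟩ := hcov h (by rwa [mul_one])
  refine ⟨π x, by simpa using ⟨x, hx, rfl⟩, π (h - x), ⟨h - x, ?_, rfl⟩, ?_⟩
  · simpa using hxh
  · simp

theorem Finset.ncard_add_le_of_subset (A X : Finset ℤ) {S T : Set ℤ} (hS : S.Finite)
    (hT : T ⊆ (X : Set ℤ) + S) :
    ((A : Set ℤ) + T).ncard ≤ X.card * ((A : Set ℤ) + S).ncard := by
  classical
  have hsub : (A : Set ℤ) + T ⊆ (X : Set ℤ) + ((A : Set ℤ) + S) := by
    rw [add_left_comm]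
    exact Set.add_subset_add_left hT
  have hfin : ((A : Set ℤ) + S).Finite := A.finite_toSet.add hS
  refine (Set.ncard_le_ncard hsub (X.finite_toSet.add hfin)).trans ?_
  lift (A : Set ℤ) + S to Finset ℤ using hfin with B
  rw [← Finset.coe_add, Set.ncard_coe_finset, Set.ncard_coe_finset]
  exact Finset.card_add_le

/-- The set `A` is comparable, up to a factor `C`, to the image in `ℤ` of the unit ball of a
locally finite subgroup of `ℝ^d`. -/
structure IsLatticeModel (A : Finset ℤ) (C : ℝ) (θ : H →+ (Fin d → ℝ)) (π : H →+ ℤ) : Prop where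
  locallyFinite : IsLocallyFinite θ.range
  ker_le : ∀ h, θ h = 0 → π h = 0
  card_le : (A.card : ℝ) ≤ C * (latticeImage θ π 1).ncard
  card_add_le : (((A : Set ℤ) + latticeImage θ π 1).ncard : ℝ) ≤ C * A.card

theorem exists_zsmul_mem_of_parallel {θ : H →+ (Fin d → ℝ)} (hfin : IsLocallyFinite θ.range)
    {x h : H} {t : ℝ} (hx : θ x = t • θ h) : ∃ a b : ℤ, a ≠ 0 ∧ θ (a • x) = θ (b • h) := by
  have hmem : ∀ j : ℕ, Int.fract (j * t) • θ h ∈ latticeBall θ.range ‖θ h‖ := by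
    intro j
    refine ⟨⟨(j : ℤ) • x - ⌊j * t⌋ • h, ?_⟩, ?_⟩
    · rw [map_sub, map_zsmul, map_zsmul, hx, ← Int.cast_smul_eq_zsmul ℝ,
        ← Int.cast_smul_eq_zsmul ℝ, smul_smul, ← sub_smul, Int.cast_natCast]
      rfl
    · rw [norm_smul, Real.norm_eq_abs, abs_of_nonneg (Int.fract_nonneg _)]
      exact mul_le_of_le_one_left (norm_nonneg _) (Int.fract_lt_one _).le
  obtain ⟨j, -, j', -, hne, heq⟩ := Set.infinite_univ.exists_ne_map_eq_of_mapsTo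
    (fun j _ => hmem j) (hfin ‖θ h‖)
  refine ⟨(j : ℤ) - j', ⌊j * t⌋ - ⌊j' * t⌋, sub_ne_zero.2 (by exact_mod_cast hne), ?_⟩
  have h1 : Int.fract (j * t) • θ h = Int.fract (j' * t) • θ h := heq
  rw [Int.fract, Int.fract, ← sub_eq_zero, ← sub_smul] at h1
  rw [← sub_eq_zero, map_zsmul, map_zsmul, hx, ← Int.cast_smul_eq_zsmul ℝ,
    ← Int.cast_smul_eq_zsmul ℝ, smul_smul, ← sub_smul, ← h1]
  congr 1
  push_cast
  ring

theorem IsLatticeModel.project {A : Finset ℤ} {C : ℝ} {θ : H →+ (Fin (d + 1) → ℝ)}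
    {π : H →+ ℤ} (hmod : IsLatticeModel A C θ π) (hC : 0 ≤ C) {h : H} (hh : θ h ≠ 0)
    (hπ : π h = 0) {m : ℕ} (hm : 1 + ‖θ h‖ ≤ m) :
    ∃ θ' : H →+ (Fin d → ℝ), IsLatticeModel A (C * ((2 * m + 1) ^ (d + 1) + 5 ^ d)) θ' π := by
  obtain ⟨T, hTv, hT2, hTker, hTlift⟩ := exists_projection hh
  have hTadd : ∀ (x : H) (n : ℤ), T (θ (x + n • h)) = T (θ x) := by
    intro x n
    rw [map_add, map_add, map_zsmul, map_zsmul, hTv, smul_zero, add_zero]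
  have hlift : ∀ x, ∃ n : ℤ, ‖θ (x + n • h)‖ ≤ ‖T (θ x)‖ + ‖θ h‖ / 2 := by
    intro x
    obtain ⟨n, hn⟩ := hTlift (θ x)
    exact ⟨n, by rwa [map_add, map_zsmul]⟩
  set θ' : H →+ (Fin d → ℝ) := (T : (Fin (d + 1) → ℝ) →+ (Fin d → ℝ)).comp θ
  have hθ' : ∀ x, θ' x = T (θ x) := fun x => rfl
  have hker : ∀ x, θ' x = 0 → π x = 0 := by
    intro x hx
    obtain ⟨t, ht⟩ := hTker _ hx
    obtain ⟨a, b, ha, hab⟩ := exists_zsmul_mem_of_parallel hmod.locallyFinite ht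
    have h1 := hmod.ker_le (a • x - b • h) (by rw [map_sub, hab, sub_self])
    rw [map_sub, map_zsmul, map_zsmul, hπ, smul_zero, sub_zero] at h1
    exact (smul_eq_zero.1 h1).resolve_left ha
  have hfin : IsLocallyFinite θ'.range := by
    rw [AddMonoidHom.range_comp]
    refine hmod.locallyFinite.map (c := ‖θ h‖ / 2) ?_
    rintro _ ⟨x, rfl⟩
    obtain ⟨n, hn⟩ := hlift x
    exact ⟨_, ⟨x + n • h, rfl⟩, hTadd x n, hn⟩
  have hA : (0 : ℝ) ≤ A.card := Nat.cast_nonneg _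
  refine ⟨θ', hfin, hker, ?_, ?_⟩
  · obtain ⟨X, hX, hcov⟩ := exists_cover_latticeImage θ' π 2
    have h1 : latticeImage θ π 1 ⊆ latticeImage θ' π (2 : ℕ) := by
      rintro _ ⟨x, hx, rfl⟩
      refine ⟨x, (hT2 _).trans ?_, rfl⟩
      have hx' : ‖θ x‖ ≤ 1 := hx
      push_cast
      linarith
    have h2 : (latticeImage θ π 1).ncard ≤ 5 ^ d * (latticeImage θ' π 1).ncard := by
      have := Finset.ncard_add_le_of_subset {0} X (finite_latticeImage hfin hker 1)
        (h1.trans hcov)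
      simp only [Finset.coe_singleton, Set.singleton_add, zero_add, Set.image_id'] at this
      exact this.trans (Nat.mul_le_mul_right _ hX)
    have h3 : ((latticeImage θ π 1).ncard : ℝ) ≤ 5 ^ d * (latticeImage θ' π 1).ncard := by
      exact_mod_cast h2
    calc (A.card : ℝ) ≤ C * (5 ^ d * (latticeImage θ' π 1).ncard) :=
          hmod.card_le.trans (mul_le_mul_of_nonneg_left h3 hC)
      _ = C * (0 + 5 ^ d) * (latticeImage θ' π 1).ncard := by ring
      _ ≤ _ := by gcongr; positivity
  · obtain ⟨X, hX, hcov⟩ := exists_cover_latticeImage θ π m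
    have h1 : latticeImage θ' π 1 ⊆ latticeImage θ π m := by
      rintro _ ⟨x, hx, rfl⟩
      obtain ⟨n, hn⟩ := hlift x
      have hx' : ‖T (θ x)‖ ≤ 1 := hx
      refine ⟨x + n • h, ?_, by rw [map_add, map_zsmul, hπ, smul_zero, add_zero]⟩
      have := norm_nonneg (θ h)
      show ‖θ (x + n • h)‖ ≤ m
      linarith
    have h2 := Finset.ncard_add_le_of_subset A X
      (finite_latticeImage hmod.locallyFinite hmod.ker_le 1) (h1.trans hcov)
    have h3 : (((A : Set ℤ) + latticeImage θ' π 1).ncard : ℝ) ≤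
        (2 * m + 1) ^ (d + 1) * ((A : Set ℤ) + latticeImage θ π 1).ncard := by
      exact_mod_cast h2.trans (Nat.mul_le_mul_right _ hX)
    calc _ ≤ (2 * (m : ℝ) + 1) ^ (d + 1) * (C * A.card) :=
          h3.trans (mul_le_mul_of_nonneg_left hmod.card_add_le (by positivity))
      _ = C * ((2 * m + 1) ^ (d + 1) + 0) * A.card := by ring
      _ ≤ _ := by gcongr; positivity

/-- Any lattice model can be replaced by one, of no larger dimension, which is injective on a ball
whose radius is as large as we please in terms of the model's constant. -/
theorem exists_injective_latticeModel (R : ℝ → ℕ) (d : ℕ) :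
    ∀ C : ℝ, 0 ≤ C → ∃ C' : ℝ, ∀ (A : Finset ℤ) (θ : H →+ (Fin d → ℝ)) (π : H →+ ℤ),
      IsLatticeModel A C θ π → ∃ (e : ℕ) (C'' : ℝ) (θ' : H →+ (Fin e → ℝ)), e ≤ d ∧ 0 ≤ C'' ∧
        C'' ≤ C' ∧ IsLatticeModel A C'' θ' π ∧ ∀ h, ‖θ' h‖ ≤ R C'' → π h = 0 → θ' h = 0 := by
  induction d with
  | zero =>
    exact fun C hC => ⟨C, fun A θ π hmod =>
      ⟨0, C, θ, le_rfl, hC, le_rfl, hmod, fun h _ _ => Subsingleton.elim _ _⟩⟩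
  | succ d ih =>
    intro C hC
    set m : ℕ := 1 + R C
    have hC1 : 0 ≤ C * ((2 * m + 1) ^ (d + 1) + 5 ^ d) := by positivity
    obtain ⟨C', hC'⟩ := ih _ hC1
    refine ⟨max C C', fun A θ π hmod => ?_⟩
    by_cases hinj : ∀ h, ‖θ h‖ ≤ R C → π h = 0 → θ h = 0
    · exact ⟨d + 1, C, θ, le_rfl, hC, le_max_left _ _, hmod, hinj⟩
    · push Not at hinj
      obtain ⟨h, hR, hπ, hne⟩ := hinj
      obtain ⟨θ', hθ'⟩ := hmod.project hC hne hπ (m := m) (by push_cast [m]; linarith)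
      obtain ⟨e, C'', θ'', he, h0, hle, h1, h2⟩ := hC' A θ' π hθ'
      exact ⟨e, C'', θ'', he.trans (Nat.le_succ d), h0, hle.trans (le_max_right _ _), h1, h2⟩

end Reduction

theorem Finset.sum_le_sum_of_card_filter_le {ι κ : Type*} (S : Finset ι) (T : Finset κ)
    (f : ι → ℝ) (h : κ → ℝ) (hh : ∀ j ∈ T, 0 ≤ h j)
    (hcard : ∀ c : ℝ, 0 < c → (S.filter fun i => c ≤ f i).card ≤ (T.filter fun j => c ≤ h j).card) :
    ∑ i ∈ S, f i ≤ ∑ j ∈ T, h j := by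
  classical
  induction S using Finset.induction_on_max_value f generalizing T with
  | empty => simpa using Finset.sum_nonneg hh
  | insert a S ha hmax ih =>
    by_cases hpos : f a ≤ 0
    · refine le_trans (Finset.sum_nonpos fun i hi => ?_) (Finset.sum_nonneg hh)
      rcases Finset.mem_insert.1 hi with rfl | hi
      · exact hpos
      · exact (hmax i hi).trans hpos
    rw [not_le] at hpos
    have h1 := hcard (f a) hpos
    have h2 : 0 < ((insert a S).filter fun i => f a ≤ f i).card :=
      Finset.card_pos.2 ⟨a, Finset.mem_filter.2 ⟨Finset.mem_insert_self _ _, le_rfl⟩⟩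
    obtain ⟨j₀, hj₀⟩ := Finset.card_pos.1 (h2.trans_le h1)
    obtain ⟨hj₀T, hj₀⟩ := Finset.mem_filter.1 hj₀
    obtain ⟨j, hjT, hj⟩ := Finset.exists_max_image T h ⟨j₀, hj₀T⟩
    have hja : f a ≤ h j := hj₀.trans (hj _ hj₀T)
    rw [Finset.sum_insert ha, ← Finset.add_sum_erase _ _ hjT]
    refine add_le_add hja (ih _ (fun i hi => hh i (Finset.mem_of_mem_erase hi)) fun c hc => ?_)
    by_cases hca : c ≤ f a
    · have h3 := hcard c hc
      rw [Finset.filter_insert, if_pos hca, Finset.card_insert_of_notMem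
        (fun h => ha (Finset.mem_filter.1 h).1)] at h3
      rw [Finset.filter_erase, Finset.card_erase_of_mem
        (Finset.mem_filter.2 ⟨hjT, hca.trans hja⟩)]
      omega
    · rw [Finset.filter_eq_empty_iff.2 fun i hi hci => hca (hci.trans (hmax i hi))]
      exact Nat.zero_le _

theorem card_add_card_le_card_add_pair {U V : Finset ℤ} (hU : U.Nonempty) (hV : V.Nonempty)
    {a b : ℤ} (hab : a ≠ b) : U.card + V.card ≤ (U + V + {a, b}).card := by
  have h1 := cauchy_davenport_add_of_linearOrder_isCancelAdd hU hV
  have h2 := cauchy_davenport_add_of_linearOrder_isCancelAdd (hU.add hV)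
    (Finset.insert_nonempty a {b})
  rw [Finset.card_pair hab] at h2
  omega

theorem two_mul_sqrt_sum_mul_sum_le {U V W : Finset ℤ} {f g h : ℤ → ℝ}
    (hf : ∀ s ∈ U, 0 < f s) (hg : ∀ t ∈ V, 0 < g t) (hh : ∀ w ∈ W, 0 ≤ h w) {a b : ℤ}
    (hab : a ≠ b) (hsub : U + V + {a, b} ⊆ W)
    (hle : ∀ s ∈ U, ∀ t ∈ V, ∀ u ∈ ({a, b} : Finset ℤ), √(f s * g t) ≤ h (s + t + u)) :
    2 * √((∑ s ∈ U, f s) * ∑ t ∈ V, g t) ≤ ∑ w ∈ W, h w := by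
  classical
  rcases U.eq_empty_or_nonempty with rfl | hU
  · simpa using Finset.sum_nonneg hh
  rcases V.eq_empty_or_nonempty with rfl | hV
  · simpa using Finset.sum_nonneg hh
  obtain ⟨s₀, hs₀, hs₀max⟩ := Finset.exists_max_image U f hU
  obtain ⟨t₀, ht₀, ht₀max⟩ := Finset.exists_max_image V g hV
  have hF := hf s₀ hs₀
  have hG := hg t₀ ht₀
  set F := f s₀
  set G := g t₀
  have hFG : 0 < √(F * G) := Real.sqrt_pos.2 (mul_pos hF hG)
  have key : ∑ i ∈ U.disjSum V, Sum.elim (fun s => f s / F) (fun t => g t / G) i ≤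
      ∑ w ∈ W, h w / √(F * G) := by
    refine Finset.sum_le_sum_of_card_filter_le _ _ _ _
      (fun w hw => div_nonneg (hh w hw) hFG.le) fun c hc => ?_
    by_cases hc1 : c ≤ 1
    · set U' := U.filter fun s => c ≤ f s / F
      set V' := V.filter fun t => c ≤ g t / G
      have hU' : U'.Nonempty := ⟨s₀, Finset.mem_filter.2 ⟨hs₀, by rwa [div_self hF.ne']⟩⟩
      have hV' : V'.Nonempty := ⟨t₀, Finset.mem_filter.2 ⟨ht₀, by rwa [div_self hG.ne']⟩⟩
      have h1 : ((U.disjSum V).filter fun i =>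
          c ≤ Sum.elim (fun s => f s / F) (fun t => g t / G) i) ⊆ U'.disjSum V' := by
        intro i hi
        obtain ⟨hi1, hi2⟩ := Finset.mem_filter.1 hi
        rcases i with s | t
        · exact Finset.inl_mem_disjSum.2
            (Finset.mem_filter.2 ⟨Finset.inl_mem_disjSum.1 hi1, hi2⟩)
        · exact Finset.inr_mem_disjSum.2
            (Finset.mem_filter.2 ⟨Finset.inr_mem_disjSum.1 hi1, hi2⟩)
      have h2 : U' + V' + {a, b} ⊆ W.filter fun w => c ≤ h w / √(F * G) := by
        intro w hw
        obtain ⟨st, hst, u, hu, rfl⟩ := Finset.mem_add.1 hw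
        obtain ⟨s, hs, t, ht, rfl⟩ := Finset.mem_add.1 hst
        obtain ⟨hs1, hs2⟩ := Finset.mem_filter.1 hs
        obtain ⟨ht1, ht2⟩ := Finset.mem_filter.1 ht
        refine Finset.mem_filter.2 ⟨hsub (Finset.add_mem_add (Finset.add_mem_add hs1 ht1) hu), ?_⟩
        rw [le_div_iff₀ hFG]
        refine le_trans ?_ (hle s hs1 t ht1 u hu)
        rw [le_div_iff₀ hF] at hs2
        rw [le_div_iff₀ hG] at ht2
        refine Real.le_sqrt_of_sq_le ?_
        rw [mul_pow, Real.sq_sqrt (mul_pos hF hG).le]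
        calc c ^ 2 * (F * G) = (c * F) * (c * G) := by ring
          _ ≤ f s * g t := mul_le_mul hs2 ht2 (by positivity) (hf s hs1).le
      calc _ ≤ (U'.disjSum V').card := Finset.card_le_card h1
        _ = U'.card + V'.card := Finset.card_disjSum _ _
        _ ≤ _ := (card_add_card_le_card_add_pair hU' hV' hab).trans (Finset.card_le_card h2)
    · rw [Finset.filter_eq_empty_iff.2, Finset.card_empty]
      · exact Nat.zero_le _
      · intro i hi hci
        rcases i with s | t
        · refine hc1 (hci.trans ?_)
          exact (div_le_one hF).2 (hs₀max s (Finset.inl_mem_disjSum.1 hi))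
        · refine hc1 (hci.trans ?_)
          exact (div_le_one hG).2 (ht₀max t (Finset.inr_mem_disjSum.1 hi))
  rw [Finset.sum_disjSum] at key
  simp only [Sum.elim_inl, Sum.elim_inr] at key
  rw [← Finset.sum_div, ← Finset.sum_div, ← Finset.sum_div, le_div_iff₀ hFG] at key
  refine le_trans ?_ key
  set x := (∑ s ∈ U, f s) / F with hx
  set y := (∑ t ∈ V, g t) / G with hy
  have hx0 : 0 ≤ x := div_nonneg (Finset.sum_nonneg fun s hs => (hf s hs).le) hF.le
  have hy0 : 0 ≤ y := div_nonneg (Finset.sum_nonneg fun t ht => (hg t ht).le) hG.le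
  have hxy : (∑ s ∈ U, f s) * ∑ t ∈ V, g t = (x * y) * (F * G) := by
    rw [hx, hy]; field_simp
  rw [hxy, Real.sqrt_mul (mul_nonneg hx0 hy0), ← mul_assoc]
  refine mul_le_mul_of_nonneg_right ?_ hFG.le
  rw [Real.sqrt_mul hx0]
  nlinarith [sq_nonneg (√x - √y), Real.sq_sqrt hx0, Real.sq_sqrt hy0]

/-- The points of `X` with first coordinate `a`, with that coordinate removed. -/
def firstSlice {k : ℕ} (X : Finset (Fin (k + 1) → ℤ)) (a : ℤ) : Finset (Fin k → ℤ) :=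
  (X.filter fun x => x 0 = a).image Fin.tail

theorem mem_firstSlice {k : ℕ} {X : Finset (Fin (k + 1) → ℤ)} {a : ℤ} {x : Fin k → ℤ} :
    x ∈ firstSlice X a ↔ (Fin.cons a x : Fin (k + 1) → ℤ) ∈ X := by
  simp only [firstSlice, Finset.mem_image, Finset.mem_filter]
  constructor
  · rintro ⟨y, ⟨hy, rfl⟩, rfl⟩
    rwa [Fin.cons_self_tail]
  · exact fun h => ⟨_, ⟨h, Fin.cons_zero _ _⟩, Fin.tail_cons _ _⟩

theorem card_firstSlice {k : ℕ} (X : Finset (Fin (k + 1) → ℤ)) (a : ℤ) :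
    (firstSlice X a).card = (X.filter fun x => x 0 = a).card := by
  refine Finset.card_image_of_injOn fun x hx y hy h => ?_
  rw [← Fin.cons_self_tail x, ← Fin.cons_self_tail y, h,
    (Finset.mem_filter.1 hx).2, (Finset.mem_filter.1 hy).2]

theorem sum_card_firstSlice {k : ℕ} {X : Finset (Fin (k + 1) → ℤ)} {U : Finset ℤ}
    (hU : ∀ x ∈ X, x 0 ∈ U) : ∑ a ∈ U, (firstSlice X a).card = X.card := by
  simp only [card_firstSlice]
  exact (Finset.card_eq_sum_card_fiberwise hU).symm

theorem firstSlice_add_subset {k : ℕ} (X Y : Finset (Fin (k + 1) → ℤ)) (a b : ℤ) :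
    firstSlice X a + firstSlice Y b ⊆ firstSlice (X + Y) (a + b) := by
  intro z hz
  obtain ⟨x, hx, y, hy, rfl⟩ := Finset.mem_add.1 hz
  rw [mem_firstSlice] at hx hy ⊢
  have : (Fin.cons (a + b) (x + y) : Fin (k + 1) → ℤ) = Fin.cons a x + Fin.cons b y := by
    ext i
    exact Fin.cases (by simp) (fun j => by simp) i
  rw [this]
  exact Finset.add_mem_add hx hy

/-- The box `∏ [-ℓ i, ℓ i]` in `ℤ^k`. -/
noncomputable def intBox {k : ℕ} (ℓ : Fin k → ℕ) : Finset (Fin k → ℤ) :=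
  Fintype.piFinset fun i => Finset.Icc (-(ℓ i : ℤ)) (ℓ i)

theorem mem_intBox {k : ℕ} {ℓ : Fin k → ℕ} {x : Fin k → ℤ} :
    x ∈ intBox ℓ ↔ ∀ i, |x i| ≤ ℓ i := by
  simp [intBox, Fintype.mem_piFinset, abs_le]

theorem card_intBox {k : ℕ} (ℓ : Fin k → ℕ) : (intBox ℓ).card = ∏ i, (2 * ℓ i + 1) := by
  rw [intBox, Fintype.card_piFinset]
  refine Finset.prod_congr rfl fun i _ => ?_
  rw [Int.card_Icc]
  omega

theorem exists_two_dense_slices {k : ℕ} {ℓ : Fin (k + 1) → ℕ} {Y : Finset (Fin (k + 1) → ℤ)}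
    (hY : Y ⊆ intBox ℓ)
    (hdense : ((intBox ℓ).card : ℝ) * ∑ i, (1 / (2 * ℓ i + 1) : ℝ) < Y.card) :
    ∃ a b : ℤ, a ≠ b ∧ ∀ u ∈ ({a, b} : Finset ℤ),
      ((intBox (Fin.tail ℓ)).card : ℝ) * ∑ i, (1 / (2 * Fin.tail ℓ i + 1) : ℝ) <
        (firstSlice Y u).card := by
  classical
  set B : ℝ := ((intBox (Fin.tail ℓ)).card : ℝ) with hB
  set σ : ℝ := ∑ i, (1 / (2 * (Fin.tail ℓ i : ℕ) + 1) : ℝ)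
  have hσ0 : 0 ≤ B * σ := by positivity
  set I : Finset ℤ := Finset.Icc (-(ℓ 0 : ℤ)) (ℓ 0)
  have hIcard : (I.card : ℝ) = 2 * ℓ 0 + 1 := by
    have : I.card = 2 * ℓ 0 + 1 := by rw [Int.card_Icc]; omega
    rw [this]; push_cast; rfl
  have hsum : ∑ a ∈ I, ((firstSlice Y a).card : ℝ) = Y.card := by
    rw [← sum_card_firstSlice (U := I) (X := Y)]
    · push_cast; rfl
    · exact fun x hx => Finset.mem_Icc.2 (abs_le.1 (mem_intBox.1 (hY hx) 0))
  have hle : ∀ a, ((firstSlice Y a).card : ℝ) ≤ B := by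
    intro a
    rw [hB]
    refine Nat.cast_le.2 (Finset.card_le_card fun x hx => mem_intBox.2 fun i => ?_)
    have := mem_intBox.1 (hY (mem_firstSlice.1 hx)) i.succ
    rwa [Fin.cons_succ] at this
  have hcard : ((intBox ℓ).card : ℝ) = (2 * ℓ 0 + 1) * B := by
    rw [hB, card_intBox, card_intBox, Fin.prod_univ_succ]
    push_cast
    rfl
  have hY' : B + (2 * ℓ 0 + 1) * (B * σ) < Y.card := by
    refine lt_of_eq_of_lt ?_ hdense
    rw [hcard, Fin.sum_univ_succ]
    have : ((2 * ℓ 0 + 1 : ℝ)) ≠ 0 := by positivity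
    simp only [σ, Fin.tail]
    field_simp
  obtain ⟨a, ha, haσ⟩ : ∃ a ∈ I, B * σ < (firstSlice Y a).card := by
    by_contra! hcon
    have := Finset.sum_le_card_nsmul _ _ _ hcon
    rw [hsum, nsmul_eq_mul, hIcard] at this
    have hB0 : 0 ≤ B := Nat.cast_nonneg _
    linarith
  obtain ⟨b, hb, hbσ⟩ : ∃ b ∈ I.erase a, B * σ < (firstSlice Y b).card := by
    by_contra! hcon
    have h1 := Finset.sum_le_card_nsmul _ _ _ hcon
    rw [← Finset.add_sum_erase _ _ ha] at hsum
    have h2 : ((I.erase a).card : ℝ) ≤ 2 * ℓ 0 + 1 := by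
      rw [← hIcard]; exact_mod_cast Finset.card_erase_le
    rw [nsmul_eq_mul] at h1
    have h3 := mul_le_mul_of_nonneg_right h2 hσ0
    linarith [hle a]
  refine ⟨a, b, (Finset.ne_of_mem_erase hb).symm, fun u hu => ?_⟩
  rcases Finset.mem_insert.1 hu with rfl | hu
  · exact haσ
  · rw [Finset.mem_singleton.1 hu]; exact hbσ

/-- A discrete Brunn–Minkowski inequality: adding a set that is sufficiently dense in a box
removes the error terms. -/
theorem two_pow_mul_sqrt_le_card_add {k : ℕ} (ℓ : Fin k → ℕ) {Y : Finset (Fin k → ℤ)}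
    (hY : Y ⊆ intBox ℓ)
    (hdense : ((intBox ℓ).card : ℝ) * ∑ i, (1 / (2 * ℓ i + 1) : ℝ) < Y.card)
    (X Z : Finset (Fin k → ℤ)) :
    2 ^ k * √(X.card * Z.card) ≤ ((X + Z + Y).card : ℝ) := by
  classical
  induction k with
  | zero =>
    rcases X.eq_empty_or_nonempty with rfl | hX
    · simp
    rcases Z.eq_empty_or_nonempty with rfl | hZ
    · simp
    have hYne : Y.Nonempty := by
      rw [← Finset.card_pos]
      simpa using hdense
    have h1 : 1 ≤ (X + Z + Y).card := Finset.card_pos.2 ((hX.add hZ).add hYne)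
    have h2 : X.card ≤ 1 := Finset.card_le_one_of_subsingleton X
    have h3 : Z.card ≤ 1 := Finset.card_le_one_of_subsingleton Z
    rw [pow_zero, one_mul]
    refine le_trans (Real.sqrt_le_one.2 ?_) (by exact_mod_cast h1)
    exact_mod_cast Nat.mul_le_mul h2 h3
  | succ k ih =>
    obtain ⟨a, b, hab, hslice⟩ := exists_two_dense_slices hY hdense
    have hYu : ∀ u, firstSlice Y u ⊆ intBox (Fin.tail ℓ) := by
      intro u x hx
      refine mem_intBox.2 fun i => ?_
      have := mem_intBox.1 (hY (mem_firstSlice.1 hx)) i.succ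
      rwa [Fin.cons_succ] at this
    set U := X.image fun x => x 0
    set V := Z.image fun x => x 0
    set W := ((X + Z + Y).image fun x => x 0) ∪ (U + V + {a, b})
    have hslicepos : ∀ (X : Finset (Fin (k + 1) → ℤ)), ∀ s ∈ X.image (fun x => x 0),
        (0 : ℝ) < (firstSlice X s).card := by
      intro X s hs
      obtain ⟨x, hx, rfl⟩ := Finset.mem_image.1 hs
      refine Nat.cast_pos.2 (Finset.card_pos.2 ⟨Fin.tail x, ?_⟩)
      rwa [mem_firstSlice, Fin.cons_self_tail]
    have key := two_mul_sqrt_sum_mul_sum_le (U := U) (V := V) (W := W)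
      (f := fun s => ((firstSlice X s).card : ℝ)) (g := fun s => ((firstSlice Z s).card : ℝ))
      (h := fun s => ((firstSlice (X + Z + Y) s).card : ℝ) / 2 ^ k)
      (hslicepos X) (hslicepos Z) (fun w _ => by positivity) hab Finset.subset_union_right
      (by
        intro s _ t _ u hu
        rw [le_div_iff₀ (by positivity), mul_comm]
        refine (ih (Fin.tail ℓ) (hYu u) (hslice u hu) _ _).trans
          (Nat.cast_le.2 (Finset.card_le_card ?_))
        exact (Finset.add_subset_add_right (firstSlice_add_subset X Z s t)).trans
          (firstSlice_add_subset (X + Z) Y (s + t) u))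
    have hX : ∑ s ∈ U, ((firstSlice X s).card : ℝ) = X.card := by
      rw [← sum_card_firstSlice (U := U) (X := X) fun x hx => Finset.mem_image_of_mem _ hx]
      push_cast; rfl
    have hZ : ∑ s ∈ V, ((firstSlice Z s).card : ℝ) = Z.card := by
      rw [← sum_card_firstSlice (U := V) (X := Z) fun x hx => Finset.mem_image_of_mem _ hx]
      push_cast; rfl
    have hW : ∑ s ∈ W, ((firstSlice (X + Z + Y) s).card : ℝ) = (X + Z + Y).card := by
      rw [← sum_card_firstSlice (U := W) (X := X + Z + Y) fun x hx =>
        Finset.mem_union_left _ (Finset.mem_image_of_mem _ hx)]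
      push_cast; rfl
    rw [hX, hZ, ← Finset.sum_div, hW, le_div_iff₀ (by positivity)] at key
    calc _ = 2 * √(X.card * Z.card) * 2 ^ k := by ring
      _ ≤ _ := key

section DimensionBound

variable {k : ℕ}

/-- The points `n` of the box with sides `R * ℓ i` for which `x + φ n` lies in `A`. -/
noncomputable def boxFiber (A : Finset ℤ) (φ : (Fin k → ℤ) →+ ℤ) (ℓ : Fin k → ℕ) (R : ℕ) (x : ℤ) :
    Finset (Fin k → ℤ) :=
  (intBox fun i => R * ℓ i).filter fun n => x + φ n ∈ A

theorem mem_boxFiber {A : Finset ℤ} {φ : (Fin k → ℤ) →+ ℤ} {ℓ : Fin k → ℕ} {R : ℕ} {x : ℤ}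
    {n : Fin k → ℤ} :
    n ∈ boxFiber A φ ℓ R x ↔ (n ∈ intBox fun i => R * ℓ i) ∧ x + φ n ∈ A :=
  Finset.mem_filter

theorem add_mem_intBox {ℓ ℓ' : Fin k → ℕ} {m n : Fin k → ℤ} (hm : m ∈ intBox ℓ)
    (hn : n ∈ intBox ℓ') : m + n ∈ intBox fun i => ℓ i + ℓ' i := by
  rw [mem_intBox] at *
  intro i
  push_cast
  exact (abs_add_le _ _).trans (add_le_add (hm i) (hn i))

theorem neg_mem_intBox {ℓ : Fin k → ℕ} {n : Fin k → ℤ} (hn : n ∈ intBox ℓ) : -n ∈ intBox ℓ := by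
  rw [mem_intBox] at *
  intro i
  rw [Pi.neg_apply, abs_neg]
  exact hn i

theorem sum_card_boxFiber (A : Finset ℤ) (φ : (Fin k → ℤ) →+ ℤ) (ℓ : Fin k → ℕ) (R : ℕ) :
    ∑ x ∈ A + (intBox fun i => R * ℓ i).image φ, (boxFiber A φ ℓ R x).card =
      A.card * (intBox fun i => R * ℓ i).card := by
  rw [← Finset.card_sigma, ← Finset.card_product]
  refine Finset.card_bij' (fun p _ => (p.1 + φ p.2, p.2)) (fun q _ => ⟨q.1 - φ q.2, q.2⟩)
    ?_ ?_ ?_ ?_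
  · rintro ⟨x, n⟩ h
    rw [Finset.mem_sigma, mem_boxFiber] at h
    exact Finset.mem_product.2 ⟨h.2.2, h.2.1⟩
  · rintro ⟨a, n⟩ h
    rw [Finset.mem_product] at h
    rw [Finset.mem_sigma, mem_boxFiber]
    refine ⟨?_, h.2, by simpa using h.1⟩
    rw [sub_eq_add_neg, ← map_neg]
    exact Finset.add_mem_add h.1 (Finset.mem_image_of_mem _ (neg_mem_intBox h.2))
  · rintro ⟨x, n⟩ _
    simp
  · rintro ⟨a, n⟩ _
    simp

theorem card_boxFiber_le {A : Finset ℤ} {φ : (Fin k → ℤ) →+ ℤ} {ℓ : Fin k → ℕ} {R : ℕ}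
    (hinj : ∀ n : Fin k → ℤ, (∀ i, |n i| ≤ 2 * R * ℓ i) → φ n = 0 → n = 0) (x : ℤ) :
    (boxFiber A φ ℓ R x).card ≤ A.card := by
  refine Finset.card_le_card_of_injOn (fun n => x + φ n) (fun n hn => (mem_boxFiber.1 hn).2) ?_
  intro m hm n hn h
  have h1 := add_mem_intBox (mem_boxFiber.1 hm).1 (neg_mem_intBox (mem_boxFiber.1 hn).1)
  rw [mem_intBox] at h1
  have h2 := hinj (m + -n) (fun i => (h1 i).trans (by push_cast; linarith))
    (by rw [map_add, map_neg]; have h' : x + φ m = x + φ n := h; linarith)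
  exact eq_of_sub_eq_zero (by rwa [sub_eq_add_neg])

theorem exists_dense_boxFiber {A : Finset ℤ} (hA : A.Nonempty) {φ : (Fin k → ℤ) →+ ℤ}
    {ℓ : Fin k → ℕ} {C : ℝ} (h1 : ((A + (intBox ℓ).image φ).card : ℝ) ≤ C * A.card) :
    ∃ x, ((intBox ℓ).card : ℝ) ≤ C * (boxFiber A φ ℓ 1 x).card := by
  have hA0 : (0 : ℝ) < A.card := Nat.cast_pos.2 hA.card_pos
  have hsum := sum_card_boxFiber A φ ℓ 1
  simp only [one_mul] at hsum
  by_contra! hcon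
  have hne : (A + (intBox ℓ).image φ).Nonempty := by
    refine hA.add ⟨φ 0, Finset.mem_image_of_mem _ (mem_intBox.2 fun i => by simp)⟩
  have h2 : ∑ x ∈ A + (intBox ℓ).image φ, C * ((boxFiber A φ ℓ 1 x).card : ℝ) <
      ∑ x ∈ A + (intBox ℓ).image φ, ((intBox ℓ).card : ℝ) :=
    Finset.sum_lt_sum_of_nonempty hne fun x _ => hcon x
  rw [← Finset.mul_sum, ← Nat.cast_sum, hsum, Finset.sum_const, nsmul_eq_mul] at h2
  have h3 := mul_le_mul_of_nonneg_right h1 (Nat.cast_nonneg (α := ℝ) (intBox ℓ).card)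
  push_cast at h2
  linarith

theorem exists_stable_scale {A : Finset ℤ} {φ : (Fin k → ℤ) →+ ℤ} {ℓ : Fin k → ℕ} {T J : ℕ}
    (hinj : ∀ n : Fin k → ℤ, (∀ i, |n i| ≤ 2 * (T ^ J : ℕ) * ℓ i) → φ n = 0 → n = 0) {x₁ : ℤ}
    (hJ : A.card < 4 ^ J * (boxFiber A φ ℓ 1 x₁).card) :
    ∃ j x₀, ∀ x, (boxFiber A φ ℓ (T ^ (j + 1)) x).card ≤ 4 * (boxFiber A φ ℓ (T ^ j) x₀).card := by
  by_contra! hcon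
  have hgrow : ∀ j, ∃ x, 4 ^ j * (boxFiber A φ ℓ 1 x₁).card ≤ (boxFiber A φ ℓ (T ^ j) x).card := by
    intro j
    induction j with
    | zero => exact ⟨x₁, by simp⟩
    | succ j ih =>
      obtain ⟨x, hx⟩ := ih
      obtain ⟨y, hy⟩ := hcon j x
      refine ⟨y, ?_⟩
      rw [pow_succ]
      linarith
  obtain ⟨x, hx⟩ := hgrow J
  exact absurd (hJ.trans_le (hx.trans (card_boxFiber_le hinj x))) (lt_irrefl _)

theorem sum_card_boxFiber_add_le (A : Finset ℤ) (φ : (Fin k → ℤ) →+ ℤ) (ℓ : Fin k → ℕ)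
    (R R' R'' : ℕ) (x₀ x₁ : ℤ) (S : Finset ℤ) :
    ∑ x ∈ S, (boxFiber A φ ℓ R x + boxFiber A φ ℓ R' x₀ + boxFiber A φ ℓ R'' x₁).card ≤
      (A + A + A).card * (intBox fun i => (R + R' + R'') * ℓ i).card := by
  rw [← Finset.card_sigma, ← Finset.card_product]
  refine Finset.card_le_card_of_injOn (fun p => (p.1 + x₀ + x₁ + φ p.2, p.2)) ?_ ?_
  · rintro ⟨x, n⟩ h
    obtain ⟨-, h⟩ := Finset.mem_sigma.1 h
    obtain ⟨m, hm, n₂, hn₂, rfl⟩ := Finset.mem_add.1 h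
    obtain ⟨n₀, hn₀, n₁, hn₁, rfl⟩ := Finset.mem_add.1 hm
    rw [mem_boxFiber] at hn₀ hn₁ hn₂
    refine Finset.mem_product.2 ⟨?_, ?_⟩
    · have : x + x₀ + x₁ + φ (n₀ + n₁ + n₂) = (x + φ n₀) + (x₀ + φ n₁) + (x₁ + φ n₂) := by
        rw [map_add, map_add]; ring
      simp only [this]
      exact Finset.add_mem_add (Finset.add_mem_add hn₀.2 hn₁.2) hn₂.2
    · have := add_mem_intBox (add_mem_intBox hn₀.1 hn₁.1) hn₂.1
      simpa only [add_mul] using this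
  · rintro ⟨x, n⟩ - ⟨y, m⟩ - h
    simp only [Prod.mk.injEq] at h
    obtain ⟨h1, rfl⟩ := h
    simpa using h1

theorem card_intBox_add_le (ℓ : Fin k → ℕ) {R R' : ℕ} (hR : R' * (k + 1) ≤ R) :
    ((intBox fun i => (R + R') * ℓ i).card : ℝ) ≤ 3 * (intBox fun i => R * ℓ i).card := by
  have hR' : (R' * (k + 1) : ℝ) ≤ R := by exact_mod_cast hR
  have hk : (0 : ℝ) < k + 1 := by positivity
  rw [card_intBox, card_intBox]
  push_cast
  have h1 : ∀ i, (2 * ((R + R' : ℝ) * ℓ i) + 1) ≤ (1 / (k + 1) + 1) * (2 * (R * ℓ i) + 1) := by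
    intro i
    have h2 : (R' : ℝ) ≤ R / (k + 1) := by rwa [le_div_iff₀ hk]
    have h3 : (R' : ℝ) * ℓ i ≤ R / (k + 1) * ℓ i := mul_le_mul_of_nonneg_right h2 (by positivity)
    have h4 : (0 : ℝ) ≤ 1 / (k + 1) := by positivity
    have h5 : (1 / (k + 1) + 1) * (2 * (R * ℓ i) + 1) =
      2 * (R * ℓ i) + 1 + 2 * (R / (k + 1) * ℓ i) + 1 / (k + 1 : ℝ) := by ring
    rw [h5]
    linarith
  calc ∏ i, (2 * ((R + R' : ℝ) * ℓ i) + 1) ≤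
        ∏ i, ((1 / (k + 1) + 1 : ℝ) * (2 * (R * ℓ i) + 1)) :=
        Finset.prod_le_prod (fun i _ => by positivity) fun i _ => h1 i
    _ = (1 / (k + 1) + 1 : ℝ) ^ k * ∏ i, (2 * (R * ℓ i : ℝ) + 1) := by
        rw [Finset.prod_mul_distrib, Finset.prod_const, Finset.card_univ, Fintype.card_fin]
    _ ≤ 3 * ∏ i, (2 * (R * ℓ i : ℝ) + 1) := by
        refine mul_le_mul_of_nonneg_right ?_ (Finset.prod_nonneg fun i _ => by positivity)
        calc (1 / (k + 1) + 1 : ℝ) ^ k ≤ Real.exp (1 / (k + 1)) ^ k :=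
              pow_le_pow_left₀ (by positivity) (Real.add_one_le_exp _) k
          _ = Real.exp (k * (1 / (k + 1))) := (Real.exp_nat_mul _ _).symm
          _ ≤ Real.exp 1 := by
              refine Real.exp_le_exp.2 ?_
              rw [mul_one_div, div_le_one hk]
              linarith
          _ ≤ 3 := by linarith [Real.exp_one_lt_d9]

/-- If `A` has small tripling and is comparable to a box with long sides that is proper at a
sufficiently large scale, then the dimension of the box is logarithmic in the tripling constant. -/
theorem two_pow_dimension_le {A : Finset ℤ} (hA : A.Nonempty) {K₃ C : ℝ}
    (h3A : ((A + A + A).card : ℝ) ≤ K₃ * A.card) {φ : (Fin k → ℤ) →+ ℤ} {ℓ : Fin k → ℕ} {J : ℕ}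
    (hℓ : ∀ i, C * (k + 1) ≤ 2 * ℓ i + 1) (h1 : ((A + (intBox ℓ).image φ).card : ℝ) ≤ C * A.card)
    (h2 : C * A.card < 4 ^ J * (intBox ℓ).card)
    (hinj : ∀ n : Fin k → ℤ, (∀ i, |n i| ≤ 2 * ((2 * (k + 1)) ^ J : ℕ) * ℓ i) → φ n = 0 → n = 0) :
    (2 : ℝ) ^ k ≤ 6 * K₃ := by
  have hA0 : (0 : ℝ) < A.card := Nat.cast_pos.2 hA.card_pos
  obtain ⟨x₁, hx₁⟩ := exists_dense_boxFiber hA h1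
  have hbox0 : (0 : ℝ) < (intBox ℓ).card := by
    rw [card_intBox]; exact_mod_cast Finset.prod_pos fun i _ => by omega
  have hC : 0 < C := by
    by_contra hC
    have := mul_nonneg (neg_nonneg.2 (not_lt.1 hC))
      (Nat.cast_nonneg (α := ℝ) (boxFiber A φ ℓ 1 x₁).card)
    linarith
  set T := 2 * (k + 1) with hT
  obtain ⟨j, x₀, hj⟩ := exists_stable_scale (A := A) hinj (x₁ := x₁) (by
    have h3 : C * A.card < C * (4 ^ J * (boxFiber A φ ℓ 1 x₁).card) := by
      calc C * A.card < 4 ^ J * (intBox ℓ).card := h2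
        _ ≤ 4 ^ J * (C * (boxFiber A φ ℓ 1 x₁).card) := by gcongr
        _ = _ := by ring
    exact_mod_cast lt_of_mul_lt_mul_left h3 hC.le)
  set Y := boxFiber A φ ℓ 1 x₁
  set Z := boxFiber A φ ℓ (T ^ j) x₀
  have hdense : ((intBox ℓ).card : ℝ) * ∑ i, (1 / (2 * ℓ i + 1) : ℝ) < Y.card := by
    have hsum : C * ∑ i, (1 / (2 * ℓ i + 1) : ℝ) < 1 := by
      calc C * ∑ i, (1 / (2 * ℓ i + 1) : ℝ) ≤ ∑ _i : Fin k, (1 / (k + 1) : ℝ) := by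
            rw [Finset.mul_sum]
            refine Finset.sum_le_sum fun i _ => ?_
            rw [mul_one_div, div_le_div_iff₀ (by positivity) (by positivity)]
            linarith [hℓ i]
        _ < 1 := by
            rw [Finset.sum_const, Finset.card_univ, Fintype.card_fin, nsmul_eq_mul, mul_one_div,
              div_lt_one (by positivity)]
            linarith
    have := mul_lt_mul_of_pos_left hsum hbox0
    refine lt_of_mul_lt_mul_left ?_ hC.le
    linarith
  have hYbox : Y ⊆ intBox ℓ := fun n hn => by simpa using (mem_boxFiber.1 hn).1
  have hX : ∀ x, (2 : ℝ) ^ k * (boxFiber A φ ℓ (T ^ (j + 1)) x).card ≤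
      2 * (boxFiber A φ ℓ (T ^ (j + 1)) x + Z + Y).card := by
    intro x
    set X := boxFiber A φ ℓ (T ^ (j + 1)) x
    have h3 := two_pow_mul_sqrt_le_card_add ℓ hYbox hdense X Z
    have h4 : (X.card : ℝ) ≤ 4 * Z.card := by exact_mod_cast hj x
    have h5 : (X.card : ℝ) / 2 ≤ √(X.card * Z.card) := by
      refine Real.le_sqrt_of_sq_le ?_
      nlinarith [Nat.cast_nonneg (α := ℝ) X.card]
    have h6 : (2 : ℝ) ^ k * (X.card / 2) ≤ 2 ^ k * √(X.card * Z.card) := by gcongr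
    linarith
  set S := A + (intBox fun i => T ^ (j + 1) * ℓ i).image φ
  set B := (intBox fun i => T ^ (j + 1) * ℓ i)
  have hB0 : (0 : ℝ) < B.card := by
    simp only [B]
    rw [card_intBox]; exact_mod_cast Finset.prod_pos fun i _ => by omega
  have hbound : ((intBox fun i => (T ^ (j + 1) + T ^ j + 1) * ℓ i).card : ℝ) ≤ 3 * B.card := by
    have hTj : 1 ≤ T ^ j := Nat.one_le_pow _ _ (by omega)
    simp only [add_assoc]
    refine card_intBox_add_le ℓ ?_
    rw [pow_succ]
    calc (T ^ j + 1) * (k + 1) ≤ (T ^ j + T ^ j) * (k + 1) := by gcongr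
      _ = T ^ j * T := by rw [hT]; ring
  have hfinal : (2 : ℝ) ^ k * (A.card * B.card) ≤ 2 * ((K₃ * A.card) * (3 * B.card)) := by
    calc (2 : ℝ) ^ k * (A.card * B.card)
        = ∑ x ∈ S, (2 : ℝ) ^ k * (boxFiber A φ ℓ (T ^ (j + 1)) x).card := by
          rw [← Finset.mul_sum, ← Nat.cast_sum, sum_card_boxFiber]
          push_cast
          rfl
      _ ≤ ∑ x ∈ S, 2 * ((boxFiber A φ ℓ (T ^ (j + 1)) x + Z + Y).card : ℝ) :=
          Finset.sum_le_sum fun x _ => hX x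
      _ ≤ 2 * ((A + A + A).card * (intBox fun i => (T ^ (j + 1) + T ^ j + 1) * ℓ i).card : ℝ) := by
          rw [← Finset.mul_sum]
          refine mul_le_mul_of_nonneg_left ?_ zero_le_two
          exact_mod_cast sum_card_boxFiber_add_le A φ ℓ _ _ _ x₀ x₁ S
      _ ≤ _ := by
          refine mul_le_mul_of_nonneg_left ?_ zero_le_two
          exact mul_le_mul h3A hbound (Nat.cast_nonneg _) ((Nat.cast_nonneg _).trans h3A)
  refine le_of_mul_le_mul_right ?_ (mul_pos hA0 hB0)
  linarith

end DimensionBound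

section Bogolyubov

open ComplexConjugate

variable {N : ℕ} [NeZero N]

/-- The Fourier transform of the indicator function of `B`. -/
noncomputable def fourierSum (B : Finset (ZMod N)) (ξ : ZMod N) : ℂ :=
  ∑ b ∈ B, ZMod.stdAddChar (ξ * b)

theorem sum_stdAddChar_mul (x : ZMod N) :
    ∑ ξ : ZMod N, (ZMod.stdAddChar (ξ * x) : ℂ) = if x = 0 then (N : ℂ) else 0 := by
  have h := AddChar.sum_mulShift x (ZMod.isPrimitive_stdAddChar N)
  rw [ZMod.card] at h
  rw [h]
  split_ifs <;> simp

theorem conj_stdAddChar (x : ZMod N) :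
    conj (ZMod.stdAddChar x : ℂ) = ZMod.stdAddChar (-x) :=
  (AddChar.map_neg_eq_conj _ _).symm

theorem fourierSum_mul_conj (B : Finset (ZMod N)) (ξ : ZMod N) :
    fourierSum B ξ * conj (fourierSum B ξ) =
      ∑ b ∈ B, ∑ b' ∈ B, ZMod.stdAddChar (ξ * (b - b')) := by
  rw [fourierSum, map_sum, Finset.sum_mul_sum]
  refine Finset.sum_congr rfl fun b _ => Finset.sum_congr rfl fun b' _ => ?_
  rw [conj_stdAddChar, ← AddChar.map_add_eq_mul]
  congr 1
  ring

theorem sum_norm_fourierSum_sq (B : Finset (ZMod N)) :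
    ∑ ξ, ‖fourierSum B ξ‖ ^ 2 = (N * B.card : ℝ) := by
  have h : ∑ ξ, fourierSum B ξ * conj (fourierSum B ξ) = (N * B.card : ℂ) := by
    simp_rw [fourierSum_mul_conj]
    rw [Finset.sum_comm]
    have h1 : ∀ b ∈ B, ∑ ξ : ZMod N, ∑ b' ∈ B, (ZMod.stdAddChar (ξ * (b - b')) : ℂ) = N := by
      intro b hb
      rw [Finset.sum_comm]
      simp_rw [sum_stdAddChar_mul, sub_eq_zero]
      simp [hb]
    rw [Finset.sum_congr rfl h1]
    simp [mul_comm]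
  simp_rw [Complex.mul_conj'] at h
  exact_mod_cast h

theorem sum_norm_fourierSum_pow_four {B : Finset (ZMod N)} {x : ZMod N}
    (hx : x ∉ B + B - (B + B)) :
    ∑ ξ, ‖fourierSum B ξ‖ ^ 4 * (ZMod.stdAddChar (ξ * x) : ℂ).re = 0 := by
  have h : ∑ ξ, (fourierSum B ξ * conj (fourierSum B ξ)) * (fourierSum B ξ *
      conj (fourierSum B ξ)) * (ZMod.stdAddChar (ξ * x) : ℂ) = 0 := by
    simp_rw [fourierSum_mul_conj, Finset.sum_mul_sum, Finset.sum_mul]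
    rw [Finset.sum_comm]
    refine Finset.sum_eq_zero fun a ha => ?_
    rw [Finset.sum_comm]
    refine Finset.sum_eq_zero fun b hb => ?_
    rw [Finset.sum_comm]
    refine Finset.sum_eq_zero fun a' ha' => ?_
    rw [Finset.sum_comm]
    refine Finset.sum_eq_zero fun b' hb' => ?_
    have h1 : ∀ ξ : ZMod N, (ZMod.stdAddChar (ξ * (a - a')) * ZMod.stdAddChar (ξ * (b - b')) *
        ZMod.stdAddChar (ξ * x) : ℂ) = ZMod.stdAddChar (ξ * (a - a' + (b - b') + x)) := by
      intro ξ
      rw [← AddChar.map_add_eq_mul, ← AddChar.map_add_eq_mul]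
      congr 1
      ring
    simp_rw [h1]
    rw [sum_stdAddChar_mul, if_neg]
    intro h2
    refine hx ?_
    have h3 : x = a' + b' - (a + b) := by linear_combination h2
    rw [h3]
    exact Finset.sub_mem_sub (Finset.add_mem_add ‹_› ‹_›) (Finset.add_mem_add ‹_› ‹_›)
  have h2 := congrArg Complex.re h
  rw [Complex.re_sum, Complex.zero_re] at h2
  rw [← h2]
  refine Finset.sum_congr rfl fun ξ _ => ?_
  rw [Complex.mul_conj', ← Complex.ofReal_pow, ← Complex.ofReal_mul, Complex.re_ofReal_mul]
  ring

/-- Bogolyubov's lemma. -/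
theorem exists_spectrum {B : Finset (ZMod N)} (hB : B.Nonempty) :
    ∃ Γ : Finset (ZMod N), (Γ.card * B.card ^ 2 : ℝ) ≤ 2 * N ^ 2 ∧
      ∀ x, (∀ ξ ∈ Γ, 0 ≤ (ZMod.stdAddChar (ξ * x) : ℂ).re) → x ∈ B + B - (B + B) := by
  classical
  have hB0 : (0 : ℝ) < B.card := by exact_mod_cast hB.card_pos
  have hN0 : (0 : ℝ) < N := by exact_mod_cast NeZero.pos N
  have hBN : (B.card : ℝ) ≤ N := by
    exact_mod_cast (Finset.card_le_univ B).trans_eq (ZMod.card N)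
  set τ : ℝ := B.card ^ 3 / (2 * N) with hτ
  have hτ0 : 0 < τ := by positivity
  have hsq := sum_norm_fourierSum_sq B
  refine ⟨Finset.univ.filter fun ξ => τ ≤ ‖fourierSum B ξ‖ ^ 2, ?_, ?_⟩
  · set Γ := Finset.univ.filter fun ξ => τ ≤ ‖fourierSum B ξ‖ ^ 2
    have h1 : Γ.card * τ ≤ N * B.card := by
      rw [← hsq, ← nsmul_eq_mul]
      refine (Finset.card_nsmul_le_sum Γ (fun ξ => ‖fourierSum B ξ‖ ^ 2) τ
        fun ξ hξ => (Finset.mem_filter.1 hξ).2).trans ?_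
      exact Finset.sum_le_sum_of_subset_of_nonneg (Finset.subset_univ _)
        fun ξ _ _ => by positivity
    rw [hτ, mul_div_assoc', div_le_iff₀ (by positivity)] at h1
    refine le_of_mul_le_mul_right ?_ hB0
    linarith
  · intro x hx
    by_contra hxB
    have h4 := sum_norm_fourierSum_pow_four hxB
    have hF0 : ‖fourierSum B 0‖ = B.card := by simp [fourierSum]
    have hterm : ∀ ξ, -(τ * ‖fourierSum B ξ‖ ^ 2) + (if ξ = 0 then (B.card : ℝ) ^ 4 else 0) ≤
        ‖fourierSum B ξ‖ ^ 4 * (ZMod.stdAddChar (ξ * x) : ℂ).re := by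
      intro ξ
      split_ifs with h0
      · subst h0
        rw [hF0]
        simp
        positivity
      · rw [add_zero]
        by_cases hξ : τ ≤ ‖fourierSum B ξ‖ ^ 2
        · have := hx ξ (Finset.mem_filter.2 ⟨Finset.mem_univ _, hξ⟩)
          have h5 : 0 ≤ ‖fourierSum B ξ‖ ^ 4 * (ZMod.stdAddChar (ξ * x) : ℂ).re := by positivity
          have h6 : 0 ≤ τ * ‖fourierSum B ξ‖ ^ 2 := by positivity
          linarith
        · have h5 : -1 ≤ (ZMod.stdAddChar (ξ * x) : ℂ).re := by
            have := (Complex.abs_re_le_norm (ZMod.stdAddChar (ξ * x) : ℂ))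
            rw [AddChar.norm_apply] at this
            exact (abs_le.1 this).1
          have h6 : ‖fourierSum B ξ‖ ^ 4 ≤ τ * ‖fourierSum B ξ‖ ^ 2 := by
            calc ‖fourierSum B ξ‖ ^ 4 = ‖fourierSum B ξ‖ ^ 2 * ‖fourierSum B ξ‖ ^ 2 := by ring
              _ ≤ _ := mul_le_mul_of_nonneg_right (not_le.1 hξ).le (by positivity)
          have h7 : 0 ≤ ‖fourierSum B ξ‖ ^ 4 := by positivity
          nlinarith
    have hsum := Finset.sum_le_sum fun ξ (_ : ξ ∈ Finset.univ) => hterm ξ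
    rw [h4, Finset.sum_add_distrib, Finset.sum_neg_distrib, ← Finset.mul_sum, hsq,
      Finset.sum_ite_eq' Finset.univ (0 : ZMod N), if_pos (Finset.mem_univ _)] at hsum
    have h8 : τ * (N * B.card) = B.card ^ 4 / 2 := by
      rw [hτ]
      field_simp
    have h9 : (0 : ℝ) < B.card ^ 4 := by positivity
    linarith

end Bogolyubov

theorem norm_sum_zsmul_le {d k : ℕ} {v : Fin k → Fin d → ℝ} {ℓ : Fin k → ℕ} {r : ℝ}
    (hv : ∑ i, ℓ i * ‖v i‖ ≤ r) {R : ℕ} {n : Fin k → ℤ} (hn : ∀ i, |n i| ≤ R * ℓ i) :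
    ‖∑ i, n i • v i‖ ≤ R * r := by
  calc ‖∑ i, n i • v i‖ ≤ ∑ i, ‖n i • v i‖ := norm_sum_le _ _
    _ ≤ ∑ i, R * (ℓ i * ‖v i‖) := by
        refine Finset.sum_le_sum fun i _ => ?_
        rw [← mul_assoc, ← Int.cast_smul_eq_zsmul ℝ, norm_smul, Real.norm_eq_abs, ← Int.cast_abs]
        refine mul_le_mul_of_nonneg_right ?_ (norm_nonneg _)
        exact_mod_cast hn i
    _ ≤ R * r := by
        rw [← Finset.mul_sum]
        exact mul_le_mul_of_nonneg_left hv (Nat.cast_nonneg _)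

section BohrSet

variable {N d : ℕ}

/-- The pairs `(z, x)` such that `z j` is a real representative of `ξ j * x / N` modulo `1`,
for every frequency `ξ j`. -/
def bohrGraph (ξ : Fin d → ZMod N) : AddSubgroup ((Fin d → ℝ) × ZMod N) where
  carrier := {p | ∀ j, ∃ m : ℤ, N * p.1 j = m ∧ (m : ZMod N) = ξ j * p.2}
  zero_mem' := fun j => ⟨0, by simp, by simp⟩
  add_mem' := by
    intro p q hp hq j
    obtain ⟨m, hm, hm'⟩ := hp j
    obtain ⟨n, hn, hn'⟩ := hq j
    refine ⟨m + n, ?_, ?_⟩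
    · push_cast
      rw [← hm, ← hn, ← mul_add]
      rfl
    · push_cast
      rw [hm', hn', ← mul_add]
      rfl
  neg_mem' := by
    intro p hp j
    obtain ⟨m, hm, hm'⟩ := hp j
    refine ⟨-m, ?_, ?_⟩
    · push_cast
      rw [← hm, ← mul_neg]
      rfl
    · push_cast
      rw [hm', ← mul_neg]
      rfl

/-- The projection of `bohrGraph ξ` to `ℝ^d`. -/
def bohrLattice (ξ : Fin d → ZMod N) : AddSubgroup (Fin d → ℝ) :=
  (bohrGraph ξ).map (AddMonoidHom.fst _ _)

theorem mem_bohrLattice {ξ : Fin d → ZMod N} {z : Fin d → ℝ} :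
    z ∈ bohrLattice ξ ↔ ∃ x, (z, x) ∈ bohrGraph ξ := by
  simp [bohrLattice]

variable [NeZero N]

theorem isLocallyFinite_bohrLattice (ξ : Fin d → ZMod N) : IsLocallyFinite (bohrLattice ξ) := by
  intro r
  have hN0 : (0 : ℝ) < N := by exact_mod_cast NeZero.pos N
  refine ((Fintype.piFinset fun _ : Fin d => Finset.Icc ⌊-(N * r)⌋ ⌈N * r⌉).finite_toSet.image
    fun m j => (m j : ℝ) / N).subset ?_
  rintro z ⟨hz, hzr⟩
  obtain ⟨x, hx⟩ := mem_bohrLattice.1 hz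
  choose m hm _ using hx
  refine ⟨m, ?_, ?_⟩
  · rw [Finset.mem_coe, Fintype.mem_piFinset]
    intro j
    have h1 : |z j| ≤ r := (norm_le_pi_norm z j).trans hzr
    have h2 : |(m j : ℝ)| ≤ N * r := by
      rw [← hm j, abs_mul, abs_of_pos hN0]
      exact mul_le_mul_of_nonneg_left h1 hN0.le
    rw [abs_le] at h2
    rw [Finset.mem_Icc]
    constructor
    · exact_mod_cast (Int.floor_le _).trans h2.1
    · exact_mod_cast h2.2.trans (Int.le_ceil _)
  · ext j
    change (m j : ℝ) / N = z j
    rw [← hm j]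
    field_simp

theorem re_stdAddChar_nonneg {ξ : Fin d → ZMod N} {z : Fin d → ℝ} {x : ZMod N}
    (hx : (z, x) ∈ bohrGraph ξ) (hz : ‖z‖ ≤ 1 / 4) (j : Fin d) :
    0 ≤ (ZMod.stdAddChar (ξ j * x) : ℂ).re := by
  have hN0 : (0 : ℝ) < N := by exact_mod_cast NeZero.pos N
  obtain ⟨m, hm, hm'⟩ := hx j
  have h1 : |z j| ≤ 1 / 4 := (norm_le_pi_norm z j).trans hz
  rw [abs_le] at h1
  change N * z j = m at hm
  change (m : ZMod N) = ξ j * x at hm'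
  rw [← hm', ZMod.stdAddChar_coe]
  have h2 : 2 * Real.pi * Complex.I * m / N = ((2 * Real.pi * z j : ℝ) : ℂ) * Complex.I := by
    have h3 : (m : ℂ) = N * z j := by exact_mod_cast hm.symm
    have h4 : (N : ℂ) ≠ 0 := by exact_mod_cast NeZero.ne N
    rw [h3]
    push_cast
    field_simp
  rw [h2, Complex.exp_ofReal_mul_I_re]
  have := Real.pi_pos
  refine Real.cos_nonneg_of_mem_Icc ⟨?_, ?_⟩ <;> nlinarith

theorem le_ncard_latticeBall_bohrLattice {ξ : Fin d → ZMod N} {j : Fin d} (hj : ξ j = 1) :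
    N ≤ (latticeBall (bohrLattice ξ) (1 / 2)).ncard := by
  have hN0 : (0 : ℝ) < N := by exact_mod_cast NeZero.pos N
  set f : ZMod N → Fin d → ℝ := fun x j => ((ξ j * x).valMinAbs : ℝ) / N with hf
  have hinj : Function.Injective f := by
    intro x y hxy
    have h := congrFun hxy j
    simp only [hf, hj, one_mul] at h
    rw [div_left_inj' hN0.ne'] at h
    exact ZMod.injective_valMinAbs (by exact_mod_cast h)
  have hsub : Set.range f ⊆ latticeBall (bohrLattice ξ) (1 / 2) := by
    rintro _ ⟨x, rfl⟩
    refine ⟨mem_bohrLattice.2 ⟨x, fun j => ⟨(ξ j * x).valMinAbs, ?_, ZMod.coe_valMinAbs _⟩⟩, ?_⟩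
    · change N * (((ξ j * x).valMinAbs : ℝ) / N) = _
      field_simp
    · rw [pi_norm_le_iff_of_nonneg (by norm_num)]
      intro j
      rw [Real.norm_eq_abs, abs_div, abs_of_pos hN0, div_le_iff₀ hN0]
      have h1 : ((ξ j * x).valMinAbs.natAbs : ℝ) ≤ N / 2 := by
        refine (Nat.cast_le.2 (ZMod.natAbs_valMinAbs_le (ξ j * x))).trans Nat.cast_div_le
      rw [Nat.cast_natAbs, Int.cast_abs] at h1
      linarith
  calc N = Nat.card (ZMod N) := (Nat.card_zmod N).symm
    _ = (Set.range f).ncard := (Set.ncard_range_of_injective hinj).symm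
    _ ≤ _ := Set.ncard_le_ncard hsub (isLocallyFinite_bohrLattice ξ _)

theorem eq_zero_of_mem_bohrGraph {ξ : Fin d → ZMod N} {z : Fin d → ℝ}
    (hz : (z, 0) ∈ bohrGraph ξ) (hzn : ‖z‖ ≤ 1 / 2) : z = 0 := by
  have hN0 : (0 : ℝ) < N := by exact_mod_cast NeZero.pos N
  ext j
  obtain ⟨m, hm, hm'⟩ := hz j
  have h1 : |z j| ≤ 1 / 2 := (norm_le_pi_norm z j).trans hzn
  change N * z j = m at hm
  change (m : ZMod N) = ξ j * 0 at hm'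
  rw [mul_zero, ZMod.intCast_zmod_eq_zero_iff_dvd] at hm'
  obtain ⟨a, rfl⟩ := hm'
  have h2 : z j = a := by
    push_cast at hm
    exact mul_left_cancel₀ hN0.ne' hm
  have h3 : |a| < 1 := by
    have : |(a : ℝ)| < 1 := by rw [← h2]; linarith
    exact_mod_cast this
  rw [h2, Int.abs_lt_one_iff.1 h3]
  simp

end BohrSet

/-- A dense set `B ⊆ ℤ/N` has the property that `2B - 2B` contains a large proper generalised
progression of bounded dimension. -/
theorem exists_box_in_two_sub_two (M : ℕ) : ∃ C : ℕ, ∀ (N : ℕ) [NeZero N] (B : Finset (ZMod N)),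
    B.Nonempty → N ≤ M * B.card → ∃ (k : ℕ) (x : Fin k → ZMod N) (ℓ : Fin k → ℕ),
      k ≤ 2 * M ^ 2 + 1 ∧ N ≤ C * ∏ i, (2 * ℓ i + 1) ∧
      (∀ n ∈ intBox ℓ, ∑ i, n i • x i ∈ B + B - (B + B)) ∧
      Set.InjOn (fun n => ∑ i, n i • x i) (intBox ℓ : Set (Fin k → ℤ)) := by
  classical
  set D := 2 * M ^ 2 + 1 with hD
  choose C hC using exists_box_in_latticeBall 0
  refine ⟨5 ^ D * (Finset.range (D + 1)).sup C, fun N _ B hB hM => ?_⟩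
  have hB0 : (0 : ℝ) < B.card := by exact_mod_cast hB.card_pos
  obtain ⟨Γ, hΓ, hΓB⟩ := exists_spectrum hB
  have hΓD : Γ.card ≤ 2 * M ^ 2 := by
    have h1 : (N : ℝ) ^ 2 ≤ (M * B.card) ^ 2 := by
      have : (N : ℝ) ≤ M * B.card := by exact_mod_cast hM
      gcongr
    have h2 : (Γ.card : ℝ) ≤ 2 * M ^ 2 := by
      refine le_of_mul_le_mul_right ?_ (pow_pos hB0 2)
      linarith
    exact_mod_cast h2
  set Γ' := insert 1 Γ
  have hd : Γ'.card ≤ D := (Finset.card_insert_le _ _).trans (by omega)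
  set d := Γ'.card
  set ξ : Fin d → ZMod N := fun j => (Γ'.equivFin.symm j : ZMod N)
  have hξ : ∀ γ ∈ Γ', ∃ j, ξ j = γ := fun γ hγ => ⟨Γ'.equivFin ⟨γ, hγ⟩, by simp [ξ]⟩
  obtain ⟨j₀, hj₀⟩ := hξ 1 (Finset.mem_insert_self _ _)
  have hfin := isLocallyFinite_bohrLattice ξ
  obtain ⟨k, v, ℓ, hkd, hv, -, hsum, hind, hcard⟩ := hC d (bohrLattice ξ) hfin (1 / 4) (by norm_num)
  choose x hx using fun i => mem_bohrLattice.1 (hv i)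
  have hgraph : ∀ n : Fin k → ℤ, (∑ i, n i • v i, ∑ i, n i • x i) ∈ bohrGraph ξ := by
    intro n
    have h := AddSubgroup.sum_mem (bohrGraph ξ) fun i (_ : i ∈ Finset.univ) =>
      AddSubgroup.zsmul_mem _ (hx i) (n i)
    convert h using 1
    ext : 1 <;> simp [Prod.fst_sum, Prod.snd_sum]
  refine ⟨k, x, ℓ, hkd.trans hd, ?_, ?_, ?_⟩
  · have h1 := le_ncard_latticeBall_bohrLattice hj₀
    have h2 := ncard_latticeBall_mul_le hfin 2 (by norm_num : (0 : ℝ) < 1 / 4)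
    norm_num at h1 h2
    norm_num at hcard
    calc N ≤ 5 ^ d * (C d * ∏ i, (2 * ℓ i + 1)) := h1.trans (h2.trans (by gcongr))
      _ ≤ 5 ^ D * ((Finset.range (D + 1)).sup C * ∏ i, (2 * ℓ i + 1)) := by
          have h3 : C d ≤ (Finset.range (D + 1)).sup C :=
            Finset.le_sup (f := C) (Finset.mem_range.2 (by omega))
          gcongr
          norm_num
      _ = _ := by ring
  · intro n hn
    refine hΓB _ fun γ hγ => ?_
    obtain ⟨j, rfl⟩ := hξ γ (Finset.mem_insert_of_mem hγ)
    refine re_stdAddChar_nonneg (hgraph n) ?_ j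
    have h1 := norm_sum_zsmul_le hsum (R := 1) (n := n) fun i => by
      simpa using (mem_intBox.1 hn) i
    simpa using h1
  · intro n hn n' hn' hnn'
    have h1 := hgraph (n - n')
    have h2 : ∑ i, (n - n') i • x i = 0 := by
      simp only [Pi.sub_apply, sub_smul, Finset.sum_sub_distrib]
      exact sub_eq_zero.2 hnn'
    rw [h2] at h1
    have h3 := norm_sum_zsmul_le hsum (R := 2) (n := n - n') fun i => by
      have h4 := mem_intBox.1 hn i
      have h5 := mem_intBox.1 hn' i
      rw [abs_le] at *
      simp only [Pi.sub_apply, Nat.cast_ofNat]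
      constructor <;> omega
    have h4 := hind _ (eq_zero_of_mem_bohrGraph h1 (h3.trans (by norm_num)))
    exact sub_eq_zero.1 h4

section Modelling

theorem card_filter_dvd_valMinAbs_le (p N : ℕ) [NeZero p] (hN : 0 < N) :
    (Finset.univ.filter fun r : ZMod p => (N : ℤ) ∣ r.valMinAbs).card ≤ 2 * (p / (2 * N)) + 1 := by
  have hcard : (Finset.Icc (-((p / (2 * N) : ℕ) : ℤ)) (p / (2 * N) : ℕ)).card =
      2 * (p / (2 * N)) + 1 := by
    rw [Int.card_Icc]
    omega
  rw [← hcard]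
  refine Finset.card_le_card_of_injOn (fun r => r.valMinAbs / N) ?_ ?_
  · intro r hr
    obtain ⟨t, ht⟩ := (Finset.mem_filter.1 hr).2
    have hN' : (N : ℤ) ≠ 0 := by exact_mod_cast hN.ne'
    have h1 := ZMod.natAbs_valMinAbs_le r
    have h2 : t.natAbs ≤ p / (2 * N) := by
      rw [ht, Int.natAbs_mul, Int.natAbs_natCast] at h1
      rw [Nat.le_div_iff_mul_le (by positivity)]
      have h3 : p / 2 * 2 ≤ p := Nat.div_mul_le_self p 2
      calc t.natAbs * (2 * N) = N * t.natAbs * 2 := by ring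
        _ ≤ p / 2 * 2 := by gcongr
        _ ≤ p := h3
    have h4 : r.valMinAbs / N = t := by rw [ht, Int.mul_ediv_cancel_left _ hN']
    simp only [h4, Finset.coe_Icc, Set.mem_Icc]
    omega
  · intro r hr r' hr' h
    have h1 := (Finset.mem_filter.1 hr).2
    have h2 := (Finset.mem_filter.1 hr').2
    refine ZMod.injective_valMinAbs ?_
    exact Int.ediv_left_inj h1 h2 |>.1 h

/-- Some dilate modulo a prime makes no element of `W` divisible by `N`. -/
theorem exists_multiplier (W : Finset ℤ) (hW : (0 : ℤ) ∉ W) {N : ℕ} (hN : 0 < N)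
    (hWN : 2 * W.card ≤ N) :
    ∃ (p : ℕ) (_ : NeZero p) (q : ZMod p), ∀ w ∈ W, ¬ (N : ℤ) ∣ (q * w).valMinAbs := by
  classical
  obtain ⟨p, hp, hprime⟩ := Nat.exists_infinite_primes (2 * W.card + ∑ w ∈ W, w.natAbs + 1)
  have : Fact p.Prime := ⟨hprime⟩
  have : NeZero p := ⟨hprime.ne_zero⟩
  refine ⟨p, inferInstance, ?_⟩
  by_contra! hbad
  set bad : ℤ → Finset (ZMod p) := fun w => Finset.univ.filter fun q => (N : ℤ) ∣ (q * w).valMinAbs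
  have hcov : (Finset.univ : Finset (ZMod p)) ⊆ W.biUnion bad := by
    intro q _
    obtain ⟨w, hw, hq⟩ := hbad q
    exact Finset.mem_biUnion.2 ⟨w, hw, Finset.mem_filter.2 ⟨Finset.mem_univ _, hq⟩⟩
  have hcard : ∀ w ∈ W, (bad w).card ≤ 2 * (p / (2 * N)) + 1 := by
    intro w hw
    refine le_trans ?_ (card_filter_dvd_valMinAbs_le p N hN)
    have hw0 : (w : ZMod p) ≠ 0 := by
      rw [Ne, ZMod.intCast_zmod_eq_zero_iff_dvd]
      intro hdvd
      have h1 : p ≤ w.natAbs := Nat.le_of_dvd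
        (Int.natAbs_pos.2 fun h => hW (h ▸ hw)) (Int.natCast_dvd.1 hdvd)
      have h2 : w.natAbs ≤ ∑ w ∈ W, w.natAbs :=
        Finset.single_le_sum (f := Int.natAbs) (fun _ _ => Nat.zero_le _) hw
      omega
    refine Finset.card_le_card_of_injOn (fun q => q * w) ?_ ?_
    · intro q hq
      exact Finset.mem_filter.2 ⟨Finset.mem_univ _, (Finset.mem_filter.1 hq).2⟩
    · exact (mul_left_injective₀ hw0).injOn
  have h1 := (Finset.card_le_card hcov).trans (Finset.card_biUnion_le_card_mul W bad _ hcard)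
  rw [Finset.card_univ, ZMod.card] at h1
  have h2 : p / (2 * N) * (2 * N) ≤ p := Nat.div_mul_le_self _ _
  have h3 : p / (2 * N) * (4 * W.card) ≤ p / (2 * N) * (2 * N) :=
    Nat.mul_le_mul_left _ (by omega)
  have h4 : W.card * (2 * (p / (2 * N)) + 1) * 2 = p / (2 * N) * (4 * W.card) + 2 * W.card := by
    ring
  omega

theorem valMinAbs_eq_of_abs_lt {p : ℕ} [NeZero p] {x : ZMod p} {s : ℤ} (hs : x = s)
    (hlt : 2 * |s| < p) : x.valMinAbs = s := by
  rw [ZMod.valMinAbs_spec]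
  have h := abs_le.1 (le_refl |s|)
  exact ⟨hs, by omega, by omega⟩

theorem exists_dense_subset_valMinAbs {p : ℕ} [NeZero p] (q : ZMod p) (A : Finset ℤ) :
    ∃ A' ⊆ A, A.card ≤ 13 * A'.card ∧
      ∀ a ∈ A', ∀ b ∈ A', 12 * |(q * a).valMinAbs - (q * b).valMinAbs| < p := by
  classical
  have hp : (0 : ℤ) < p := by exact_mod_cast NeZero.pos p
  set cls : ℤ → ℤ := fun a => 12 * (q * (a : ZMod p)).valMinAbs / p
  have hcls : Set.MapsTo cls A (Finset.Icc (-6 : ℤ) 6) := by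
    intro a _
    have h := ZMod.valMinAbs_mem_Ioc (q * (a : ZMod p))
    rw [Set.mem_Ioc] at h
    rw [Finset.mem_coe, Finset.mem_Icc]
    constructor
    · rw [Int.le_ediv_iff_mul_le hp]
      linarith
    · refine Int.le_of_lt_add_one (Int.ediv_lt_of_lt_mul hp ?_)
      linarith
  obtain ⟨c, -, hc⟩ : ∃ c ∈ Finset.Icc (-6 : ℤ) 6,
      A.card ≤ 13 * (A.filter fun a => cls a = c).card := by
    refine Finset.exists_le_of_sum_le ⟨0, by simp⟩ ?_
    rw [← Finset.mul_sum, ← Finset.card_eq_sum_card_fiberwise hcls]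
    simp
  refine ⟨_, Finset.filter_subset _ _, hc, fun a ha b hb => ?_⟩
  have h1 := (Finset.mem_filter.1 ha).2
  have h2 := (Finset.mem_filter.1 hb).2
  have h3 := Int.emod_add_mul_ediv (12 * (q * a).valMinAbs) p
  have h4 := Int.emod_add_mul_ediv (12 * (q * b).valMinAbs) p
  have h5 := Int.emod_nonneg (12 * (q * a).valMinAbs) hp.ne'
  have h6 := Int.emod_nonneg (12 * (q * b).valMinAbs) hp.ne'
  have h7 := Int.emod_lt_of_pos (12 * (q * a).valMinAbs) hp
  have h8 := Int.emod_lt_of_pos (12 * (q * b).valMinAbs) hp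
  change 12 * (q * a).valMinAbs / p = c at h1
  change 12 * (q * b).valMinAbs / p = c at h2
  rw [h1] at h3
  rw [h2] at h4
  have h9 : |12 * (q * a).valMinAbs - 12 * (q * b).valMinAbs| < p := by
    rw [abs_lt]
    constructor <;> linarith
  rwa [← mul_sub, abs_mul] at h9

/-- Ruzsa's modelling lemma: a large part of `A` is modelled by a subset `B` of `ℤ/N`, in such a
way that `2B - 2B` maps injectively and additively to `2A - 2A`. -/
theorem exists_model {A : Finset ℤ} (hA : A.Nonempty) {N : ℕ} [NeZero N]
    (hN : 2 * (6 • A - 6 • A).card ≤ N) :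
    ∃ (B : Finset (ZMod N)) (f : ZMod N → ℤ), A.card ≤ 13 * B.card ∧
      (∀ x ∈ B + B - (B + B), f x ∈ A + A - (A + A)) ∧
      Set.InjOn f (B + B - (B + B) : Finset (ZMod N)) ∧
      ∀ x ∈ B + B - (B + B), ∀ y ∈ B + B - (B + B), x + y ∈ B + B - (B + B) →
        f (x + y) = f x + f y := by
  classical
  obtain ⟨p, hp, q, hq⟩ := exists_multiplier ((6 • A - 6 • A).erase 0) (Finset.notMem_erase _ _)
    (NeZero.pos N) (le_trans (by gcongr; exact Finset.erase_subset _ _) hN)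
  obtain ⟨A', hsubset, hcard, hclose⟩ := exists_dense_subset_valMinAbs q A
  have hA' : A'.Nonempty := by
    rw [← Finset.card_pos]
    have := hA.card_pos
    omega
  set ρ : ℤ → ℤ := fun z => (q * z).valMinAbs with hρ
  have hcoe : ∀ z, (ρ z : ZMod p) = q * z := fun z => ZMod.coe_valMinAbs _
  set T := A' + A' - (A' + A') with hT
  have hTA : T ⊆ A + A - (A + A) :=
    Finset.sub_subset_sub (Finset.add_subset_add hsubset hsubset) (Finset.add_subset_add hsubset hsubset)
  have h6 : 6 • A - 6 • A = (A + A - (A + A)) + (A + A - (A + A)) - (A + A - (A + A)) := by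
    have h : 6 • A = 2 • A + 2 • A + 2 • A := by rw [← add_nsmul, ← add_nsmul]
    rw [h, ← two_nsmul A, sub_add_sub_comm, sub_eq_add_neg (2 • A + 2 • A - (2 • A + 2 • A)),
      neg_sub, sub_add_sub_comm]
  have hW : ∀ z ∈ T, ∀ z' ∈ T, ∀ z'' ∈ T, (N : ℤ) ∣ ρ (z + z' - z'') → z + z' - z'' = 0 := by
    intro z hz z' hz' z'' hz'' hdvd
    by_contra h0
    refine hq _ (Finset.mem_erase.2 ⟨h0, ?_⟩) hdvd
    rw [h6]
    exact Finset.sub_mem_sub (Finset.add_mem_add (hTA hz) (hTA hz')) (hTA hz'')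
  have hρT : ∀ a ∈ A', ∀ a' ∈ A', ∀ b ∈ A', ∀ b' ∈ A',
      ρ (a + a' - (b + b')) = ρ a + ρ a' - (ρ b + ρ b') ∧ 6 * |ρ (a + a' - (b + b'))| < p := by
    intro a ha a' ha' b hb b' hb'
    have h1 := abs_lt.1 (by simpa [abs_mul] using hclose a ha b hb :
      |12 * (ρ a - ρ b)| < p)
    have h2 := abs_lt.1 (by simpa [abs_mul] using hclose a' ha' b' hb' :
      |12 * (ρ a' - ρ b')| < p)
    have h3 : 6 * |ρ a + ρ a' - (ρ b + ρ b')| < p := by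
      have : |6 * (ρ a + ρ a' - (ρ b + ρ b'))| < p := by
        rw [abs_lt]
        constructor <;> linarith
      simpa [abs_mul] using this
    have h4 : ρ (a + a' - (b + b')) = ρ a + ρ a' - (ρ b + ρ b') := by
      refine valMinAbs_eq_of_abs_lt ?_ (by have := abs_nonneg (ρ a + ρ a' - (ρ b + ρ b')); omega)
      push_cast
      rw [hcoe, hcoe, hcoe, hcoe]
      ring
    exact ⟨h4, by rwa [h4]⟩
  have hsmall : ∀ z ∈ T, 6 * |ρ z| < p := by
    intro z hz
    obtain ⟨s, hs, t, ht, rfl⟩ := Finset.mem_sub.1 hz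
    obtain ⟨a, ha, a', ha', rfl⟩ := Finset.mem_add.1 hs
    obtain ⟨b, hb, b', hb', rfl⟩ := Finset.mem_add.1 ht
    exact (hρT a ha a' ha' b hb b' hb').2
  set B := A'.image fun a => (ρ a : ZMod N) with hB
  have hsurj : ∀ x ∈ B + B - (B + B), ∃ z ∈ T, (ρ z : ZMod N) = x := by
    intro x hx
    obtain ⟨s, hs, t, ht, rfl⟩ := Finset.mem_sub.1 hx
    obtain ⟨x, hxB, x', hx', rfl⟩ := Finset.mem_add.1 hs
    obtain ⟨y, hy, y', hy', rfl⟩ := Finset.mem_add.1 ht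
    obtain ⟨a, ha, rfl⟩ := Finset.mem_image.1 hxB
    obtain ⟨a', ha', rfl⟩ := Finset.mem_image.1 hx'
    obtain ⟨b, hb, rfl⟩ := Finset.mem_image.1 hy
    obtain ⟨b', hb', rfl⟩ := Finset.mem_image.1 hy'
    refine ⟨a + a' - (b + b'), Finset.sub_mem_sub (Finset.add_mem_add ha ha')
      (Finset.add_mem_add hb hb'), ?_⟩
    rw [(hρT a ha a' ha' b hb b' hb').1]
    push_cast
    ring
  have hadd : ∀ z ∈ T, ∀ z' ∈ T, ∀ z'' ∈ T,
      (ρ z'' : ZMod N) = ρ z + ρ z' → z'' = z + z' := by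
    intro z hz z' hz' z'' hz'' h
    have h1 := abs_lt.1 (by simpa [abs_mul] using hsmall z hz : |6 * ρ z| < p)
    have h2 := abs_lt.1 (by simpa [abs_mul] using hsmall z' hz' : |6 * ρ z'| < p)
    have h3 := abs_lt.1 (by simpa [abs_mul] using hsmall z'' hz'' : |6 * ρ z''| < p)
    have h4 : ρ (z + z' - z'') = ρ z + ρ z' - ρ z'' := by
      refine valMinAbs_eq_of_abs_lt ?_ ?_
      · push_cast
        rw [hcoe, hcoe, hcoe]
        ring
      · have : |2 * (ρ z + ρ z' - ρ z'')| < p := by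
          rw [abs_lt]
          constructor <;> linarith
        simpa [abs_mul] using this
    have h5 := hW z hz z' hz' z'' hz'' (by
      rw [h4, ← ZMod.intCast_zmod_eq_zero_iff_dvd]
      push_cast
      rw [h, sub_self])
    linarith
  have hT0 : ∀ a ∈ A', ∀ b ∈ A', a - b ∈ T := by
    intro a ha b hb
    have h : a - b = a + a - (b + a) := by ring
    rw [h]
    exact Finset.sub_mem_sub (Finset.add_mem_add ha ha) (Finset.add_mem_add hb ha)
  have hBcard : B.card = A'.card := by
    refine Finset.card_image_of_injOn fun a ha b hb hab => ?_
    have hab' : (ρ a : ZMod N) = ρ b := hab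
    have h0 : (0 : ℤ) ∈ T := by simpa using hT0 a ha a ha
    have hρ0 : ρ 0 = 0 := by simp [hρ]
    have h1 : ρ (a - b) = ρ a - ρ b := by
      have h := (hρT a ha a ha b hb a ha).1
      rw [show a + a - (b + a) = a - b by ring] at h
      rw [h]
      ring
    have h2 := hadd 0 h0 (a - b) (hT0 a ha b hb) 0 h0 (by
      rw [h1, hρ0]
      push_cast
      rw [hab', sub_self, add_zero])
    linarith
  have hsurj' : ∀ x, ∃ z, x ∈ B + B - (B + B) → z ∈ T ∧ (ρ z : ZMod N) = x := by
    intro x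
    by_cases hx : x ∈ B + B - (B + B)
    · obtain ⟨z, hz⟩ := hsurj x hx
      exact ⟨z, fun _ => hz⟩
    · exact ⟨0, fun h => absurd h hx⟩
  choose f hf using hsurj'
  refine ⟨B, f, by rwa [hBcard], fun x hx => hTA (hf x hx).1, ?_, ?_⟩
  · intro x hx y hy hxy
    rw [← (hf x hx).2, ← (hf y hy).2, hxy]
  · intro x hx y hy hxy
    refine hadd _ (hf x hx).1 _ (hf y hy).1 _ (hf _ hxy).1 ?_
    rw [(hf x hx).2, (hf y hy).2, (hf _ hxy).2]

end Modelling

section IntBox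

variable {k : ℕ}

/-- A function that is additive on a box centred at the origin is given there by a linear form. -/
theorem eq_sum_zsmul_of_add_intBox {ℓ : Fin k → ℕ} {F : (Fin k → ℤ) → ℤ}
    (hF : ∀ n ∈ intBox ℓ, ∀ m ∈ intBox ℓ, n + m ∈ intBox ℓ → F (n + m) = F n + F m)
    {n : Fin k → ℤ} (hn : n ∈ intBox ℓ) : F n = ∑ i, n i • F (Pi.single i 1) := by
  classical
  have h0 : (0 : Fin k → ℤ) ∈ intBox ℓ := mem_intBox.2 fun i => by simp
  induction hs : ∑ i, (n i).natAbs using Nat.strong_induction_on generalizing n with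
  | _ s ih =>
    by_cases hn0 : n = 0
    · subst hn0
      have := hF 0 h0 0 h0 (by simpa using h0)
      simp only [add_zero] at this
      simp only [Pi.zero_apply, zero_smul, Finset.sum_const_zero]
      linarith
    · obtain ⟨i, hi⟩ : ∃ i, n i ≠ 0 := by
        by_contra! h
        exact hn0 (funext h)
      have hbox := mem_intBox.1 hn
      have he : (Pi.single i 1 : Fin k → ℤ) ∈ intBox ℓ := by
        refine mem_intBox.2 fun j => ?_
        rcases eq_or_ne j i with rfl | hj
        · have := hbox j
          have := Int.one_le_abs hi
          simp only [Pi.single_eq_same, abs_one]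
          linarith
        · simp [hj]
      have key : ∀ m : Fin k → ℤ, (∀ j, j ≠ i → m j = n j) → (m i).natAbs < (n i).natAbs →
          m ∈ intBox ℓ ∧ F m = ∑ i, m i • F (Pi.single i 1) := by
        intro m hm hmi
        have hmbox : m ∈ intBox ℓ := by
          refine mem_intBox.2 fun j => ?_
          have := hbox j
          rcases eq_or_ne j i with rfl | hj
          · rw [Int.abs_eq_natAbs] at this ⊢
            omega
          · rwa [hm j hj]
        refine ⟨hmbox, ih _ ?_ hmbox rfl⟩
        rw [← hs]
        refine Finset.sum_lt_sum (fun j _ => ?_) ⟨i, Finset.mem_univ _, hmi⟩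
        rcases eq_or_ne j i with rfl | hj
        · exact hmi.le
        · rw [hm j hj]
      have hsum : ∀ m : Fin k → ℤ, ∑ j, (m + Pi.single i 1 : Fin k → ℤ) j • F (Pi.single j 1) =
          ∑ j, m j • F (Pi.single j 1) + F (Pi.single i 1) := by
        intro m
        simp only [Pi.add_apply, add_smul, Finset.sum_add_distrib]
        congr 1
        rw [Finset.sum_eq_single i]
        · simp
        · intro j _ hj
          simp [hj]
        · simp
      rcases lt_or_gt_of_ne hi with hneg | hpos
      · obtain ⟨hm, hFm⟩ := key (n + Pi.single i 1) (fun j hj => by simp [hj])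
          (by simp only [Pi.add_apply, Pi.single_eq_same]; omega)
        have h1 := hF n hn _ he hm
        rw [hFm, hsum] at h1
        exact (add_right_cancel h1).symm
      · obtain ⟨hm, hFm⟩ := key (n - Pi.single i 1) (fun j hj => by simp [hj])
          (by simp only [Pi.sub_apply, Pi.single_eq_same]; omega)
        have h1 := hF _ hm _ he (by simpa using hn)
        rw [hFm, ← hsum] at h1
        simpa using h1

end IntBox

theorem card_nsmul_sub_nsmul_le {A : Finset ℤ} (hA : A.Nonempty) {K : ℝ}
    (hAK : ((A + A).card : ℝ) ≤ K * A.card) (m n : ℕ) :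
    ((m • A - n • A).card : ℝ) ≤ K ^ (m + n) * A.card := by
  have h := Finset.pluennecke_ruzsa_inequality_nsmul_sub_nsmul_add hA A m n
  have h' : ((m • A - n • A).card : ℝ) ≤ ((A + A).card / A.card : ℝ) ^ (m + n) * A.card := by
    have h1 := (NNRat.cast_le (K := ℝ)).2 h
    push_cast at h1
    exact h1
  have hA0 : (0 : ℝ) < A.card := by exact_mod_cast hA.card_pos
  refine h'.trans ?_
  gcongr
  rwa [div_le_iff₀ hA0]

/-- If `A` has small doubling then `2A - 2A` contains a large proper generalised progression of
bounded dimension. -/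
theorem exists_box_in_two_sub_two_int (K : ℝ) : ∃ D C : ℕ, ∀ A : Finset ℤ, A.Nonempty →
    ((A + A).card : ℝ) ≤ K * A.card → ∃ (k : ℕ) (u : Fin k → ℤ) (ℓ : Fin k → ℕ), k ≤ D ∧
      A.card ≤ C * ∏ i, (2 * ℓ i + 1) ∧
      (∀ n ∈ intBox ℓ, ∑ i, n i • u i ∈ A + A - (A + A)) ∧
      Set.InjOn (fun n => ∑ i, n i • u i) (intBox ℓ : Set (Fin k → ℤ)) := by
  classical
  set M : ℕ := ⌈26 * K ^ 12⌉₊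
  obtain ⟨C, hC⟩ := exists_box_in_two_sub_two M
  refine ⟨2 * M ^ 2 + 1, 13 * C, fun A hA hAK => ?_⟩
  set N := 2 * (6 • A - 6 • A).card with hN
  have hN0 : N ≠ 0 := by
    have : (6 • A - 6 • A).Nonempty := hA.nsmul.sub hA.nsmul
    have := this.card_pos
    omega
  have : NeZero N := ⟨hN0⟩
  obtain ⟨B, f, hAB, hfA, hinj, hadd⟩ := exists_model hA hN.ge
  have hBpos : 0 < B.card := by
    have := hA.card_pos
    omega
  have hNB : N ≤ M * B.card := by
    have h1 : (N : ℝ) ≤ M * B.card := by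
      have h2 := card_nsmul_sub_nsmul_le hA hAK 6 6
      have h3 : 26 * K ^ 12 ≤ M := Nat.le_ceil _
      have h4 : (A.card : ℝ) ≤ 13 * B.card := by exact_mod_cast hAB
      have h5 : (0 : ℝ) ≤ K ^ 12 := Even.pow_nonneg (by decide) K
      calc (N : ℝ) = 2 * (6 • A - 6 • A).card := by exact_mod_cast hN
        _ ≤ 2 * (K ^ 12 * A.card) := by gcongr
        _ ≤ 2 * (K ^ 12 * (13 * B.card)) := by gcongr
        _ = 26 * K ^ 12 * B.card := by ring
        _ ≤ M * B.card := by gcongr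
    exact_mod_cast h1
  obtain ⟨k, x, ℓ, hk, hNC, hbox, hxinj⟩ := hC N B (Finset.card_pos.1 hBpos) hNB
  set F : (Fin k → ℤ) → ℤ := fun n => f (∑ i, n i • x i) with hF
  have hFlin : ∀ n ∈ intBox ℓ, F n = ∑ i, n i • F (Pi.single i 1) := by
    intro n hn
    refine eq_sum_zsmul_of_add_intBox (fun n hn m hm hnm => ?_) hn
    have h : ∑ i, (n + m) i • x i = ∑ i, n i • x i + ∑ i, m i • x i := by
      simp only [Pi.add_apply, add_smul, Finset.sum_add_distrib]
    have h' := hbox _ hnm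
    simp only [hF, h] at h' ⊢
    exact hadd _ (hbox n hn) _ (hbox m hm) h'
  refine ⟨k, fun i => F (Pi.single i 1), ℓ, hk, ?_, ?_, ?_⟩
  · calc A.card ≤ 13 * B.card := hAB
      _ ≤ 13 * N := by
          gcongr
          exact (Finset.card_le_univ B).trans_eq (ZMod.card N)
      _ ≤ 13 * (C * ∏ i, (2 * ℓ i + 1)) := by gcongr
      _ = _ := by ring
  · intro n hn
    rw [← hFlin n hn]
    exact hfA _ (hbox n hn)
  · intro n hn m hm hnm
    have h : F n = F m := by rw [hFlin n hn, hFlin m hm]; exact hnm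
    exact hxinj hn hm (hinj (hbox n hn) (hbox m hm) h)

section BoxModel

variable {k : ℕ}

/-- The embedding of `ℤ^k` in `ℝ^k` that identifies a box with the integer points of the unit
ball. -/
noncomputable def boxEmbedding (ℓ : Fin k → ℕ) : (Fin k → ℤ) →+ (Fin k → ℝ) :=
  AddMonoidHom.mk' (fun n i => (n i : ℝ) / (ℓ i + 1 / 2)) fun n m => by
    ext i
    simp [add_div]

theorem boxEmbedding_apply (ℓ : Fin k → ℕ) (n : Fin k → ℤ) (i : Fin k) :
    boxEmbedding ℓ n i = (n i : ℝ) / (ℓ i + 1 / 2) := rfl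

theorem norm_boxEmbedding_le_iff (ℓ : Fin k → ℕ) (n : Fin k → ℤ) {r : ℝ} (hr : 0 ≤ r) :
    ‖boxEmbedding ℓ n‖ ≤ r ↔ ∀ i, |(n i : ℝ)| ≤ r * (ℓ i + 1 / 2) := by
  rw [pi_norm_le_iff_of_nonneg hr]
  refine forall_congr' fun i => ?_
  have h : (0 : ℝ) < ℓ i + 1 / 2 := by positivity
  rw [boxEmbedding_apply, Real.norm_eq_abs, abs_div, abs_of_pos h, div_le_iff₀ h]

theorem norm_boxEmbedding_le_one_iff (ℓ : Fin k → ℕ) (n : Fin k → ℤ) :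
    ‖boxEmbedding ℓ n‖ ≤ 1 ↔ n ∈ intBox ℓ := by
  rw [norm_boxEmbedding_le_iff ℓ n zero_le_one, mem_intBox]
  refine forall_congr' fun i => ?_
  rw [one_mul, ← Int.cast_abs]
  constructor
  · intro h
    have h1 : ((|n i| : ℤ) : ℝ) < (ℓ i + 1 : ℤ) := by
      push_cast at h ⊢
      linarith
    have h2 : |n i| < ℓ i + 1 := by exact_mod_cast h1
    omega
  · intro h
    have h1 : ((|n i| : ℤ) : ℝ) ≤ (ℓ i : ℤ) := by exact_mod_cast h
    rw [Int.cast_natCast] at h1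
    linarith

theorem boxEmbedding_eq_zero {ℓ : Fin k → ℕ} {n : Fin k → ℤ} (h : boxEmbedding ℓ n = 0) :
    n = 0 := by
  ext i
  have h1 := congrFun h i
  rw [boxEmbedding_apply, Pi.zero_apply, div_eq_zero_iff] at h1
  have h2 : (0 : ℝ) < ℓ i + 1 / 2 := by positivity
  exact_mod_cast h1.resolve_right h2.ne'

theorem isLocallyFinite_range_boxEmbedding (ℓ : Fin k → ℕ) :
    IsLocallyFinite (boxEmbedding ℓ).range := by
  intro r
  rcases lt_or_ge r 0 with hr | hr
  · refine Set.finite_empty.subset fun x hx => ?_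
    exact absurd (hx.2.trans_lt hr) (norm_nonneg x).not_gt
  · refine ((Fintype.piFinset fun i =>
      Finset.Icc (-⌊r * (ℓ i + 1 / 2)⌋) ⌊r * (ℓ i + 1 / 2)⌋).finite_toSet.image
        (boxEmbedding ℓ)).subset ?_
    rintro _ ⟨⟨n, rfl⟩, hn⟩
    refine ⟨n, ?_, rfl⟩
    rw [Finset.mem_coe, Fintype.mem_piFinset]
    intro i
    have h := (norm_boxEmbedding_le_iff ℓ n hr).1 hn i
    rw [Finset.mem_Icc, ← abs_le, Int.le_floor, Int.cast_abs]
    exact h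

theorem isLatticeModel_boxEmbedding {A : Finset ℤ} (hA : A.Nonempty) {K : ℝ}
    (hAK : ((A + A).card : ℝ) ≤ K * A.card) {u : Fin k → ℤ} {ℓ : Fin k → ℕ} {C : ℕ}
    (hcard : A.card ≤ C * ∏ i, (2 * ℓ i + 1))
    (hbox : ∀ n ∈ intBox ℓ, ∑ i, n i • u i ∈ A + A - (A + A))
    (hinj : Set.InjOn (fun n => ∑ i, n i • u i) (intBox ℓ : Set (Fin k → ℤ))) :
    IsLatticeModel A (max C (K ^ 5)) (boxEmbedding ℓ)
      (Fintype.linearCombination ℤ u).toAddMonoidHom := by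
  classical
  have himage : latticeImage (boxEmbedding ℓ) (Fintype.linearCombination ℤ u).toAddMonoidHom 1 =
      ((intBox ℓ).image fun n => ∑ i, n i • u i : Finset ℤ) := by
    rw [latticeImage, Finset.coe_image]
    congr 1
    ext n
    exact norm_boxEmbedding_le_one_iff ℓ n
  refine ⟨isLocallyFinite_range_boxEmbedding ℓ, fun n hn => ?_, ?_, ?_⟩
  · rw [boxEmbedding_eq_zero hn, map_zero]
  · rw [himage, Set.ncard_coe_finset, Finset.card_image_of_injOn hinj, card_intBox]
    calc (A.card : ℝ) ≤ C * (∏ i, (2 * ℓ i + 1) : ℕ) := by exact_mod_cast hcard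
      _ ≤ _ := by
          gcongr
          exact le_max_left _ _
  · rw [himage, ← Finset.coe_add, Set.ncard_coe_finset]
    have hsub : A + (intBox ℓ).image (fun n => ∑ i, n i • u i) ⊆ 3 • A - 2 • A := by
      have h : 3 • A - 2 • A = A + (A + A - (A + A)) := by
        rw [← two_nsmul, ← add_sub_assoc, ← succ_nsmul']
      rw [h]
      exact Finset.add_subset_add_left (Finset.image_subset_iff.2 hbox)
    calc ((A + (intBox ℓ).image fun n => ∑ i, n i • u i).card : ℝ)
        ≤ (3 • A - 2 • A).card := by exact_mod_cast Finset.card_le_card hsub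
      _ ≤ K ^ 5 * A.card := card_nsmul_sub_nsmul_le hA hAK 3 2
      _ ≤ _ := by
          gcongr
          exact le_max_right _ _

end BoxModel

/-- A box on which the projection of a lattice model is injective up to a large scale has bounded
dimension. -/
theorem IsLatticeModel.exists_proper_box {H : Type*} [AddCommGroup H] {A : Finset ℤ}
    (hA : A.Nonempty) {K : ℝ} (hAK : ((A + A).card : ℝ) ≤ K * A.card) {e : ℕ} {C : ℝ}
    (hC : 0 ≤ C) {θ : H →+ (Fin e → ℝ)} {π : H →+ ℤ} (hmod : IsLatticeModel A C θ π)
    {M g J : ℕ} (hM : C * (e + 1) ≤ M)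
    (hg : ∀ Λ : AddSubgroup (Fin e → ℝ), IsLocallyFinite Λ → ∀ r : ℝ, 0 < r →
      ∃ (k : ℕ) (v : Fin k → Fin e → ℝ) (ℓ : Fin k → ℕ), k ≤ e ∧ (∀ i, v i ∈ Λ) ∧
        (∀ i, M ≤ ℓ i) ∧ ∑ i, ℓ i * ‖v i‖ ≤ r ∧
        (∀ n : Fin k → ℤ, ∑ i, n i • v i = 0 → n = 0) ∧
        (latticeBall Λ r).ncard ≤ g * ∏ i, (2 * ℓ i + 1))
    (hJ : C * (C * g) < 4 ^ J)
    (hinj : ∀ h, ‖θ h‖ ≤ (2 * (2 * (e + 1)) ^ J : ℕ) → π h = 0 → θ h = 0) :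
    ∃ (k : ℕ) (φ : (Fin k → ℤ) →+ ℤ) (ℓ : Fin k → ℕ), (2 : ℝ) ^ k ≤ 6 * K ^ 3 ∧
      Set.InjOn φ (intBox ℓ : Set (Fin k → ℤ)) ∧
      (A.card : ℝ) ≤ C * g * (intBox ℓ).card ∧
      ((A + (intBox ℓ).image φ).card : ℝ) ≤ C * A.card := by
  classical
  obtain ⟨k, v, ℓ, hke, hv, hℓ, hsum, hind, hcard⟩ := hg θ.range hmod.locallyFinite 1 one_pos
  choose h hh using hv
  set ψ : (Fin k → ℤ) →+ H := (Fintype.linearCombination ℤ h).toAddMonoidHom with hψ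
  have hθψ : ∀ n, θ (ψ n) = ∑ i, n i • v i := by
    intro n
    have : ψ n = ∑ i, n i • h i := Fintype.linearCombination_apply ℤ h n
    rw [this, map_sum]
    exact Finset.sum_congr rfl fun i _ => by rw [map_zsmul, hh]
  set φ : (Fin k → ℤ) →+ ℤ := π.comp ψ with hφ
  have hscale : ∀ {R : ℕ} {n : Fin k → ℤ}, R ≤ 2 * (2 * (e + 1)) ^ J →
      (∀ i, |n i| ≤ R * ℓ i) → φ n = 0 → n = 0 := by
    intro R n hR hn hn0
    refine hind n ?_
    rw [← hθψ]
    refine hinj (ψ n) ?_ hn0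
    rw [hθψ]
    refine (norm_sum_zsmul_le hsum hn).trans ?_
    rw [mul_one]
    exact_mod_cast hR
  have hadd : ((A + (intBox ℓ).image φ).card : ℝ) ≤ C * A.card := by
    refine le_trans ?_ hmod.card_add_le
    rw [← Set.ncard_coe_finset, Finset.coe_add]
    refine Nat.cast_le.2 (Set.ncard_le_ncard (Set.add_subset_add_left ?_)
      (A.finite_toSet.add (finite_latticeImage hmod.locallyFinite hmod.ker_le 1)))
    intro y hy
    obtain ⟨n, hn, rfl⟩ := Finset.mem_image.1 (Finset.mem_coe.1 hy)
    refine ⟨ψ n, ?_, rfl⟩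
    change ‖θ (ψ n)‖ ≤ 1
    rw [hθψ]
    have h1 := norm_sum_zsmul_le hsum (R := 1) (n := n) fun i => by
      simpa using (mem_intBox.1 hn) i
    simpa using h1
  have hAbox : (A.card : ℝ) ≤ C * g * (intBox ℓ).card := by
    have h1 := (ncard_latticeImage_le hmod.locallyFinite hmod.ker_le 1).trans hcard
    rw [← card_intBox] at h1
    calc (A.card : ℝ) ≤ C * (latticeImage θ π 1).ncard := hmod.card_le
      _ ≤ C * (g * (intBox ℓ).card) := by
          gcongr
          exact_mod_cast h1
      _ = _ := by ring
  have hbox0 : (0 : ℝ) < (intBox ℓ).card := by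
    rw [card_intBox]
    exact_mod_cast Finset.prod_pos fun i _ => by omega
  refine ⟨k, φ, ℓ, ?_, ?_, hAbox, hadd⟩
  · refine two_pow_dimension_le hA (C := C) (J := J) ?_ (fun i => ?_) hadd ?_ fun n hn => ?_
    · have h3 := card_nsmul_sub_nsmul_le hA hAK 3 0
      rw [zero_nsmul, sub_zero, succ_nsmul, two_nsmul] at h3
      exact h3
    · have h1 : (M : ℝ) ≤ ℓ i := by exact_mod_cast hℓ i
      have h2 : (k : ℝ) ≤ e := by exact_mod_cast hke
      have h3 : C * (k + 1) ≤ C * (e + 1) := by gcongr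
      have h4 : (0 : ℝ) ≤ ℓ i := Nat.cast_nonneg _
      linarith
    · calc C * A.card ≤ C * (C * g * (intBox ℓ).card) := by gcongr
        _ = C * (C * g) * (intBox ℓ).card := by ring
        _ < _ := by gcongr
    · refine hscale (R := 2 * (2 * (k + 1)) ^ J) (by gcongr) fun i => ?_
      have := hn i
      push_cast at this ⊢
      exact this
  · intro n hn m hm hnm
    have h1 : n - m = 0 := by
      refine hscale (R := 2) ?_ (fun i => ?_) (by rw [map_sub, sub_eq_zero]; exact hnm)
      · have : 1 ≤ (2 * (e + 1)) ^ J := Nat.one_le_pow _ _ (by omega)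
        omega
      · have h4 := mem_intBox.1 hn i
        have h5 := mem_intBox.1 hm i
        rw [abs_le] at *
        simp only [Pi.sub_apply, Nat.cast_ofNat]
        constructor <;> omega
    exact sub_eq_zero.1 h1

theorem exists_proper_box (K : ℝ) : ∃ C : ℝ, ∀ A : Finset ℤ, A.Nonempty →
    ((A + A).card : ℝ) ≤ K * A.card → ∃ (k : ℕ) (φ : (Fin k → ℤ) →+ ℤ) (ℓ : Fin k → ℕ),
      (2 : ℝ) ^ k ≤ 6 * K ^ 3 ∧ Set.InjOn φ (intBox ℓ : Set (Fin k → ℤ)) ∧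
      (A.card : ℝ) ≤ C * (intBox ℓ).card ∧
      ((A + (intBox ℓ).image φ).card : ℝ) ≤ C * A.card := by
  classical
  obtain ⟨D, C₀, hC₀⟩ := exists_box_in_two_sub_two_int K
  choose g hg using exists_box_in_latticeBall
  set M : ℝ → ℕ := fun x => ⌈x * (D + 1)⌉₊
  set G : ℝ → ℕ := fun x =>
    (Finset.range (M x + 1)).sup fun m => (Finset.range (D + 1)).sup (g m)
  have hGmono : Monotone G := by
    intro x y hxy
    refine Finset.sup_mono (Finset.range_subset_range.2 ?_)
    have : M x ≤ M y := Nat.ceil_mono (by gcongr)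
    omega
  have hgG : ∀ x e, e ≤ D → g (M x) e ≤ G x := by
    intro x e he
    refine le_trans (Finset.le_sup (f := g (M x)) (Finset.mem_range.2 (by omega : e < D + 1))) ?_
    exact Finset.le_sup (f := fun m => (Finset.range (D + 1)).sup (g m))
      (Finset.mem_range.2 (Nat.lt_succ_self _))
  set J : ℝ → ℕ := fun x => ⌈x * (x * G x)⌉₊
  have hJ : ∀ x, x * (x * G x) < 4 ^ J x := by
    intro x
    refine (Nat.le_ceil _).trans_lt ?_
    exact_mod_cast Nat.lt_pow_self (by norm_num : 1 < 4)
  set R : ℝ → ℕ := fun x => 2 * (2 * (D + 1)) ^ J x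
  choose C' hC' using fun k => exists_injective_latticeModel (H := Fin k → ℤ) R k
    (max C₀ (K ^ 5)) ((Nat.cast_nonneg _).trans (le_max_left _ _))
  set C₁ : ℝ := ∑ k ∈ Finset.range (D + 1), |C' k|
  have hC₁ : ∀ k, k ≤ D → C' k ≤ C₁ := fun k hk => (le_abs_self _).trans
    (Finset.single_le_sum (f := fun k => |C' k|) (fun _ _ => abs_nonneg _)
      (Finset.mem_range.2 (by omega)))
  refine ⟨max C₁ (C₁ * G C₁), fun A hA hAK => ?_⟩
  obtain ⟨k, u, ℓ, hkD, hcard, hbox, hinj⟩ := hC₀ A hA hAK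
  obtain ⟨e, C, θ, hek, hC0, hCC', hmod, hR⟩ := hC' k A _ _
    (isLatticeModel_boxEmbedding hA hAK hcard hbox hinj)
  have heD : e ≤ D := hek.trans hkD
  have heD' : (e : ℝ) ≤ D := by exact_mod_cast heD
  have hCC₁ : C ≤ C₁ := hCC'.trans (hC₁ k hkD)
  have hgC : (g (M C) e : ℝ) ≤ G C := by exact_mod_cast hgG C e heD
  have hGC : (G C : ℝ) ≤ G C₁ := by exact_mod_cast hGmono hCC₁
  obtain ⟨k', φ, ℓ', hk', hφ, hAbox, hadd⟩ := hmod.exists_proper_box hA hAK hC0 (M := M C)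
    (g := g (M C) e) (J := J C) ((by gcongr : C * (e + 1) ≤ C * (D + 1)).trans (Nat.le_ceil _))
    (hg (M C) e) ((by gcongr : C * (C * g (M C) e) ≤ C * (C * G C)).trans_lt (hJ C))
    fun h hh => hR h (hh.trans (by
      refine Nat.cast_le.2 ?_
      change _ ≤ 2 * (2 * (D + 1)) ^ J C
      gcongr))
  refine ⟨k', φ, ℓ', hk', hφ, hAbox.trans ?_, hadd.trans ?_⟩
  · gcongr
    refine le_trans ?_ (le_max_right _ _)
    have : (g (M C) e : ℝ) ≤ G C₁ := hgC.trans hGC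
    gcongr
  · gcongr
    exact hCC₁.trans (le_max_left _ _)

theorem natCast_add_one_le_of_two_pow_le {k : ℕ} {K : ℝ} (hK : 1 ≤ K)
    (hk : (2 : ℝ) ^ k ≤ 6 * K ^ 3) : ((k + 1 : ℕ) : ℝ) ≤ 5 * (1 + Real.log K) := by
  have hK0 : 0 < K := by linarith
  have h1 : Real.log (2 ^ k) ≤ Real.log (2 ^ 3 * K ^ 3) := by
    refine Real.log_le_log (by positivity) (hk.trans ?_)
    have : 0 < K ^ 3 := by positivity
    linarith
  rw [Real.log_mul (by positivity) (by positivity), Real.log_pow, Real.log_pow, Real.log_pow] at h1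
  have h2 := Real.log_two_gt_d9
  have h3 := Real.log_nonneg hK
  push_cast at h1 ⊢
  have h4 : 0.69 * ((k : ℝ) - 3) ≤ 3 * Real.log K := by
    rcases le_total (k : ℝ) 3 with h | h
    · nlinarith
    · nlinarith
  linarith

/-- A set comparable to a proper box that it is nearly invariant under is commensurable to a
progression of one dimension more. -/
theorem exists_commensurable_progression {A : Finset ℤ} (hA : A.Nonempty) {C : ℝ} {k : ℕ}
    {φ : (Fin k → ℤ) →+ ℤ} {ℓ : Fin k → ℕ} (hφ : Set.InjOn φ (intBox ℓ : Set (Fin k → ℤ)))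
    (hAbox : (A.card : ℝ) ≤ C * (intBox ℓ).card)
    (hadd : ((A + (intBox ℓ).image φ).card : ℝ) ≤ C * A.card) :
    ∃ (π : (Fin (k + 1) → ℤ) →+ ℤ) (L : Fin (k + 1) → ℕ), max (A.card : ℝ) ((intBox L).image π).card
      ≤ C * (C + 3) * (A ∩ (intBox L).image π).card := by
  classical
  have hA0 : (0 : ℝ) < A.card := by exact_mod_cast hA.card_pos
  have hC0 : 0 < C := by
    by_contra hC
    have := mul_nonneg (neg_nonneg.2 (not_lt.1 hC)) (Nat.cast_nonneg (α := ℝ) (intBox ℓ).card)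
    linarith
  obtain ⟨x, hx⟩ := exists_dense_boxFiber hA hadd
  set π : (Fin (k + 1) → ℤ) →+ ℤ := AddMonoidHom.mk' (fun n => n 0 * x + φ (Fin.tail n)) (by
    intro n m
    have : Fin.tail (n + m) = Fin.tail n + Fin.tail m := rfl
    rw [this, map_add, Pi.add_apply]
    ring) with hπ
  set L : Fin (k + 1) → ℕ := Fin.cons 1 ℓ with hL
  have hfib : (boxFiber A φ ℓ 1 x).card ≤ (A ∩ (intBox L).image π).card := by
    refine Finset.card_le_card_of_injOn (fun n => x + φ n) ?_ ?_
    · intro n hn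
      obtain ⟨hn, hnA⟩ := mem_boxFiber.1 hn
      refine Finset.mem_inter.2 ⟨hnA, Finset.mem_image.2 ⟨Fin.cons 1 n, ?_, ?_⟩⟩
      · refine mem_intBox.2 fun i => ?_
        refine Fin.cases ?_ (fun j => ?_) i
        · simp [hL]
        · simpa [hL] using mem_intBox.1 hn j
      · simp [hπ]
    · intro n hn m hm hnm
      have h1 := (mem_boxFiber.1 hn).1
      have h2 := (mem_boxFiber.1 hm).1
      simp only [one_mul] at h1 h2
      exact hφ h1 h2 (add_left_cancel hnm)
  have hfib' : ((boxFiber A φ ℓ 1 x).card : ℝ) ≤ (A ∩ (intBox L).image π).card := by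
    exact_mod_cast hfib
  have hP : (((intBox L).image π).card : ℝ) ≤ 3 * (intBox ℓ).card := by
    have h1 : ((intBox L).image π).card ≤ 3 * (intBox ℓ).card := by
      refine Finset.card_image_le.trans_eq ?_
      rw [card_intBox, card_intBox, Fin.prod_univ_succ]
      simp [hL]
    exact_mod_cast h1
  have hbox : ((intBox ℓ).card : ℝ) ≤ C * (A ∩ (intBox L).image π).card := hx.trans (by gcongr)
  set Q : ℝ := ((A ∩ (intBox L).image π).card : ℝ)
  have hQ : 0 ≤ Q := Nat.cast_nonneg _
  refine ⟨π, L, max_le ?_ ?_⟩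
  · nlinarith
  · nlinarith

/-- **Freiman–Ruzsa–Chang theorem.** There is an absolute constant `c > 0` such that
for every `K ≥ 1` there exists `C(K) > 0` with the property that every finite nonempty
subset `A ⊆ ℤ` with `|A+A| ≤ K|A|` is `C(K)`-commensurable to a `d`-dimensional
arithmetic progression `P ⊆ ℤ` (the image of a box `∏ [-Lᵢ, Lᵢ]` under a homomorphism
`ℤ^d → ℤ`) with `d ≤ c·(1 + log K)`. -/
theorem freiman_ruzsa_chang :
    ∃ c : ℝ, 0 < c ∧ ∀ K : ℝ, 1 ≤ K → ∃ C : ℝ, 0 < C ∧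
      ∀ A : Finset ℤ, A.Nonempty → ((A + A).card : ℝ) ≤ K * A.card →
        ∃ (d : ℕ) (π : (Fin d → ℤ) →+ ℤ) (L : Fin d → ℕ) (P : Finset ℤ),
          P = (Fintype.piFinset fun i => Finset.Icc (-(L i : ℤ)) (L i)).image (fun x => π x) ∧
          (d : ℝ) ≤ c * (1 + Real.log K) ∧
          ((A ∩ P).card : ℝ) ≥ (1 / C) * max (A.card : ℝ) (P.card : ℝ) := by
  refine ⟨5, by norm_num, fun K hK => ?_⟩
  obtain ⟨C, hC⟩ := exists_proper_box K
  refine ⟨|C| * (|C| + 3) + 1, by positivity, fun A hA hAK => ?_⟩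
  obtain ⟨k, φ, ℓ, hk, hφ, hAbox, hadd⟩ := hC A hA hAK
  obtain ⟨π, L, hπ⟩ := exists_commensurable_progression hA hφ
    (hAbox.trans (mul_le_mul_of_nonneg_right (le_abs_self C) (Nat.cast_nonneg _)))
    (hadd.trans (mul_le_mul_of_nonneg_right (le_abs_self C) (Nat.cast_nonneg _)))
  refine ⟨k + 1, π, L, (intBox L).image π, rfl,
    natCast_add_one_le_of_two_pow_le hK hk, ?_⟩
  rw [ge_iff_le, one_div, inv_mul_le_iff₀ (by positivity)]
  refine hπ.trans (mul_le_mul_of_nonneg_right ?_ (Nat.cast_nonneg _))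
  linarith
end
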